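/- arXiv:2508.12152 — 4 statements merged into one kernel-verified Lean document; each statement's English description precedes it below -/
import Mathlib

section
/- For every natural number n, the following identity of signed representation counts holds: #{(x,y) ∈ ℤ² : 2x² + 3y² = 144n + 30, (x mod 24, y mod 24) ∈ {(3,2), (3,22), (9,10), (9,14)}} - #{(x,y) ∈ ℤ² : 2x² + 3y² = 144n + 30, (x mod 24, y mod 24) ∈ {(15,2), (15,22), (21,10), (21,14)}} = 2·( #{(x,y) ∈ ℤ² : x² + y² = 24n + 5, (x ≡ 2 (mod 24) and y ≡ 1 (mod 12)) or (x ≡ 10 (mod 24) and y ≡ 5 (mod 12))} - #{(x,y) ∈ ℤ² : x² + y² = 24n + 5, (x ≡ 2 (mod 24) and y ≡ 5 (mod 12)) or (x ≡ 10 (mod 24) and y ≡ 1 (mod 12))} ). -/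
theorem aux_shanks {R : Type*} [CommRing R] (q : R) (n : ℕ) :
    ∑ s ∈ Finset.range n, (∏ k ∈ Finset.Ico s n, (1 - q ^ (2 * k + 2))) *
      (∏ k ∈ Finset.range s, (1 - q ^ (2 * k + 1))) * q ^ (s * (2 * n + 1)) =
    (∏ k ∈ Finset.range n, (1 - q ^ (2 * k + 1))) *
      ∑ i ∈ Finset.range n, (q ^ (i * (2 * i + 1)) + q ^ ((i + 1) * (2 * i + 1))) := by
  induction n with
  | zero => simp
  | succ n ih =>
    have key : ∀ m, m ≤ n → ∑ s ∈ Finset.range m, ((∏ k ∈ Finset.Ico s n, (1 - q ^ (2 * k + 2))) *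
        (∏ k ∈ Finset.range s, (1 - q ^ (2 * k + 1))) * q ^ (s * (2 * n + 1))) *
          ((1 - q ^ (2 * n + 2)) * q ^ (2 * s) - (1 - q ^ (2 * n + 1))) =
        ((∏ k ∈ Finset.Ico m n, (1 - q ^ (2 * k + 2))) *
        (∏ k ∈ Finset.range m, (1 - q ^ (2 * k + 1))) * q ^ (m * (2 * n + 1))) *
          (1 - q ^ (2 * m)) := by
      intro m
      induction m with
      | zero => simp
      | succ m ihm =>
        intro hm
        rw [Finset.sum_range_succ, ihm (by omega), Finset.prod_range_succ,
          Finset.prod_eq_prod_Ico_succ_bot (show m < n by omega)]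
        ring
    have h1 : ∑ s ∈ Finset.range (n + 1), (∏ k ∈ Finset.Ico s (n + 1), (1 - q ^ (2 * k + 2))) *
      (∏ k ∈ Finset.range s, (1 - q ^ (2 * k + 1))) * q ^ (s * (2 * (n + 1) + 1)) =
      (∑ s ∈ Finset.range n, ((∏ k ∈ Finset.Ico s n, (1 - q ^ (2 * k + 2))) *
        (∏ k ∈ Finset.range s, (1 - q ^ (2 * k + 1))) * q ^ (s * (2 * n + 1))) *
          ((1 - q ^ (2 * n + 2)) * q ^ (2 * s))) +
        (1 - q ^ (2 * n + 2)) *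
      (∏ k ∈ Finset.range n, (1 - q ^ (2 * k + 1))) * q ^ (n * (2 * (n + 1) + 1)) := by
      rw [Finset.sum_range_succ]
      congr 1
      · refine Finset.sum_congr rfl fun s hs => ?_
        rw [Finset.prod_Ico_succ_top (by simp at hs; omega)]
        ring
      · simp
    have h2 := key n le_rfl
    simp only [mul_sub, Finset.sum_sub_distrib] at h2
    rw [← Finset.sum_mul] at h2
    simp only [mul_one, Finset.Ico_self, Finset.prod_empty, one_mul] at h2
    rw [h1, Finset.prod_range_succ, Finset.sum_range_succ]
    simp only [mul_sub, mul_one] at ih ⊢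
    have h3 := sub_eq_iff_eq_add.mp h2
    rw [h3]
    rw [← Finset.sum_mul, ih]
    ring

open Polynomial in
theorem aux_pent (M : ℕ) : ∃ N0 : ℕ, ∀ N ≥ N0, ∀ K : ℕ, K ≥ M →
    (X : ℤ[X]) ^ M ∣ ∏ k ∈ Finset.range N, (1 - X ^ (k + 1)) -
      ∑ k ∈ Finset.Ico (-K : ℤ) K, C ((Int.negOnePow k : ℤˣ) : ℤ) * X ^ pentagonal k := by
  have h := fun d => (PowerSeries.coeff_prod_one_sub_X_pow_eventually_eq ℤ d)
  have h' : ∀ᶠ s in Filter.atTop, ∀ d ∈ Finset.range M,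
    (∏ n ∈ s, (1 - PowerSeries.X ^ (n + 1) : PowerSeries ℤ)).coeff d =
      (PowerSeries.pentagonalSeries ℤ).coeff d :=
    (Finset.eventually_all _).2 fun d _ => h d
  obtain ⟨s0, hs0⟩ := Filter.eventually_atTop.1 h'
  obtain ⟨N0, hN0⟩ := s0.exists_nat_subset_range
  refine ⟨N0, fun N hN K hK => ?_⟩
  rw [X_pow_dvd_iff]
  intro d hd
  have h1 := hs0 (Finset.range N) (hN0.trans (Finset.range_mono hN)) d (by simpa using hd)
  have h2 : (∏ k ∈ Finset.range N, (1 - X ^ (k + 1)) : ℤ[X]).coeff d =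
      (PowerSeries.pentagonalSeries ℤ).coeff d := by
    rw [← h1, ← Polynomial.coeff_coe]
    congr 1
    rw [← Polynomial.coeToPowerSeries.ringHom_apply, map_prod]
    simp
  rw [coeff_sub, h2, finsetSum_coeff]
  simp only [coeff_C_mul, coeff_X_pow]
  by_cases hk : d ∈ Set.range pentagonal
  · obtain ⟨k, rfl⟩ := hk
    rw [PowerSeries.coeff_pentagonalSeries_pentagonal, Finset.sum_eq_single k]
    · simp only [if_true, mul_one, Int.cast_id, sub_self]
    · intro b _ hb
      rw [if_neg (by rw [pentagonal_inj]; exact hb.symm)]; simp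
    · intro hk
      exfalso; apply hk
      have h3 := two_mul_natCast_pentagonal k
      have : (pentagonal k : ℤ) < K := by exact_mod_cast lt_of_lt_of_le hd hK
      rw [Finset.mem_Ico]
      constructor <;> nlinarith
  · rw [PowerSeries.coeff_pentagonalSeries_eq_zero _ hk, Finset.sum_eq_zero]
    · simp
    · intro k _
      rw [if_neg (by rintro rfl; exact hk ⟨k, rfl⟩)]; simp

/-- The generalized triangular number `j(2j+1)`. -/
def auxTri (j : ℤ) : ℕ := (j * (2 * j + 1)).toNat

theorem auxTri_cast (j : ℤ) : (auxTri j : ℤ) = j * (2 * j + 1) := by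
  unfold auxTri
  rw [Int.toNat_of_nonneg]
  rcases le_or_gt 0 j with h | h
  · positivity
  · nlinarith

open Polynomial in
theorem aux_tri_sum (L : ℕ) :
    ∑ i ∈ Finset.range L, ((-X : ℤ[X]) ^ (i * (2 * i + 1)) + (-X) ^ ((i + 1) * (2 * i + 1))) =
    ∑ j ∈ Finset.Ico (-L : ℤ) L, C ((Int.negOnePow j : ℤˣ) : ℤ) * X ^ auxTri j := by
  induction L with
  | zero => simp
  | succ L ih =>
    have h : Finset.Ico (-((L + 1 : ℕ) : ℤ)) ((L + 1 : ℕ) : ℤ) =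
        insert (L : ℤ) (insert (-(L + 1 : ℤ)) (Finset.Ico (-L : ℤ) L)) := by
      ext x; simp only [Finset.mem_Ico, Finset.mem_insert]; push_cast; omega
    rw [h, Finset.sum_insert (by simp; omega), Finset.sum_insert (by simp), ← ih,
      Finset.sum_range_succ]
    have h1 : auxTri L = L * (2 * L + 1) := by
      have := auxTri_cast L
      exact_mod_cast this
    have h2 : auxTri (-(L + 1 : ℤ)) = (L + 1) * (2 * L + 1) := by
      have := auxTri_cast (-(L + 1 : ℤ))
      have h3 : ((auxTri (-(L + 1 : ℤ)) : ℕ) : ℤ) = (((L + 1) * (2 * L + 1) : ℕ) : ℤ) := by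
        rw [this]; push_cast; ring
      exact_mod_cast h3
    rw [h1, h2, Int.negOnePow_neg, Int.negOnePow_succ]
    have h4 : ((Int.negOnePow (L : ℤ) : ℤˣ) : ℤ) = (-1) ^ L := by
      rw [Int.negOnePow_def, zpow_natCast, Units.val_pow_eq_pow_val]; rfl
    have e1 : (-1 : ℤ[X]) ^ (L * (2 * L + 1)) = (-1) ^ L := by
      rw [mul_comm, pow_mul, Odd.neg_one_pow ⟨L, rfl⟩]
    have e2 : (-1 : ℤ[X]) ^ ((L + 1) * (2 * L + 1)) = -(-1) ^ L := by
      rw [mul_comm, pow_mul, Odd.neg_one_pow ⟨L, rfl⟩, pow_succ]; ring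
    rw [neg_pow (X : ℤ[X]), neg_pow (X : ℤ[X]), e1, e2, Units.val_neg, h4]
    simp only [map_neg, map_pow, map_one]
    ring

theorem aux_split {R : Type*} [CommRing R] (q : R) (n : ℕ) :
    ∏ k ∈ Finset.range (2 * n), (1 - q ^ (k + 1)) =
    (∏ k ∈ Finset.range n, (1 - q ^ (2 * k + 1))) *
      ∏ k ∈ Finset.range n, (1 - q ^ (2 * k + 2)) := by
  induction n with
  | zero => simp
  | succ n ih =>
    rw [show 2 * (n + 1) = 2 * n + 1 + 1 by ring, Finset.prod_range_succ, Finset.prod_range_succ,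
      ih, Finset.prod_range_succ, Finset.prod_range_succ]
    ring

open Polynomial in
theorem aux_cong (M : ℕ) : ∃ L0 : ℕ, ∀ L ≥ L0, ∀ P : ℤ[X],
    P = ∑ k ∈ Finset.Ico (-L : ℤ) L, C ((Int.negOnePow k : ℤˣ) : ℤ) * X ^ pentagonal k →
    (X : ℤ[X]) ^ M ∣ expand ℤ 2 P *
      (∑ j ∈ Finset.Ico (-L : ℤ) L, C ((Int.negOnePow j : ℤˣ) : ℤ) * X ^ auxTri j)
      - P * expand ℤ 4 P := by
  obtain ⟨N0, hN0⟩ := aux_pent M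
  refine ⟨N0 + M, fun L hL P hP => ?_⟩
  have hdvd : ∀ (m : ℕ) (A B : ℤ[X]), 0 < m → X ^ M ∣ A - B →
      X ^ M ∣ expand ℤ m A - expand ℤ m B := by
    intro m A B hm h
    rw [← map_sub]
    have h2 := map_dvd (expand ℤ m) h
    rw [map_pow, expand_X, ← pow_mul] at h2
    exact (pow_dvd_pow X (Nat.le_mul_of_pos_left M hm)).trans h2
  have ha := hN0 (2 * L) (by omega) L (by omega)
  have hb := hN0 L (by omega) L (by omega)
  rw [← hP] at ha hb
  have ha2 := hdvd 2 _ _ (by norm_num) ha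
  have hb4 := hdvd 4 _ _ (by norm_num) hb
  rw [← aux_tri_sum]
  set S := ∑ i ∈ Finset.range L, ((-X : ℤ[X]) ^ (i * (2 * i + 1)) + (-X) ^ ((i + 1) * (2 * i + 1)))
    with hS
  have hsh := aux_shanks (-X : ℤ[X]) L
  rw [← hS] at hsh
  set O := ∏ k ∈ Finset.range L, (1 - (-X : ℤ[X]) ^ (2 * k + 1)) with hO
  set O' := ∏ k ∈ Finset.range L, (1 - (X : ℤ[X]) ^ (2 * k + 1)) with hO'
  set E := ∏ k ∈ Finset.range L, (1 - (X : ℤ[X]) ^ (2 * k + 2)) with hE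
  set a := ∏ k ∈ Finset.range (2 * L), (1 - (X : ℤ[X]) ^ (k + 1)) with haa
  set b := ∏ k ∈ Finset.range L, (1 - (X : ℤ[X]) ^ (k + 1)) with hbb
  have h1 : a = O' * E := aux_split X L
  have h2 : expand ℤ 2 a = O * O' * expand ℤ 4 b := by
    have : expand ℤ 2 a = ∏ k ∈ Finset.range (2 * L), (1 - (X ^ 2 : ℤ[X]) ^ (k + 1)) := by
      simp [haa, map_prod]
    have e1 : ∏ k ∈ Finset.range L, (1 - (X ^ 2 : ℤ[X]) ^ (2 * k + 1)) = O * O' := by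
      rw [hO, hO', ← Finset.prod_mul_distrib]
      refine Finset.prod_congr rfl fun k _ => ?_
      rw [Odd.neg_pow ⟨k, rfl⟩]
      ring
    have e2 : ∏ k ∈ Finset.range L, (1 - (X ^ 2 : ℤ[X]) ^ (2 * k + 2)) = expand ℤ 4 b := by
      rw [hbb, map_prod]
      refine Finset.prod_congr rfl fun k _ => ?_
      simp only [map_sub, map_one, map_pow, expand_X]
      ring
    rw [this, aux_split, e1, e2]
  have h3 : X ^ M ∣ O * S - E := by
    rw [← hsh]
    obtain ⟨l, rfl⟩ | hl : (∃ l, L = l + 1) ∨ L = 0 := by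
      rcases L with _ | l
      · right; rfl
      · left; exact ⟨l, rfl⟩
    · rw [Finset.sum_range_succ']
      have : (∏ k ∈ Finset.Ico 0 (l + 1), (1 - (-X : ℤ[X]) ^ (2 * k + 2))) = E := by
        rw [hE, Nat.Ico_zero_eq_range]
        refine Finset.prod_congr rfl fun k _ => ?_
        rw [Even.neg_pow ⟨k + 1, by ring⟩]
      rw [this]
      simp only [Finset.range_zero, Finset.prod_empty, mul_one, zero_mul, pow_zero,
        add_sub_cancel_right]
      refine Finset.dvd_sum fun s _ => Dvd.dvd.mul_left ?_ _
      rw [neg_pow]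
      refine Dvd.dvd.mul_left (pow_dvd_pow (X : ℤ[X]) ?_) _
      nlinarith
    · subst hl
      have : M = 0 := by omega
      simp [this]
  have : expand ℤ 2 P * S - P * expand ℤ 4 P =
      -(expand ℤ 2 a - expand ℤ 2 P) * S + expand ℤ 4 b * O' * (O * S - E)
      + (a - P) * expand ℤ 4 b + P * (expand ℤ 4 b - expand ℤ 4 P) := by
    rw [h2, h1]; ring
  rw [this]
  refine dvd_add (dvd_add (dvd_add ?_ ?_) ?_) ?_
  · exact Dvd.dvd.mul_right (by rwa [dvd_neg]) _
  · exact Dvd.dvd.mul_left h3 _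
  · exact Dvd.dvd.mul_right ha _
  · exact Dvd.dvd.mul_left hb4 _

open Polynomial in
theorem aux_coeff (n : ℕ) : ∃ L : ℕ, n < L ∧
    ∑ p ∈ (Finset.Ico (-L : ℤ) L ×ˢ Finset.Ico (-L : ℤ) L) with 2 * pentagonal p.1 + auxTri p.2 = n,
      ((Int.negOnePow (p.1 + p.2) : ℤˣ) : ℤ) =
    ∑ p ∈ (Finset.Ico (-L : ℤ) L ×ˢ Finset.Ico (-L : ℤ) L) with
      pentagonal p.1 + 4 * pentagonal p.2 = n, ((Int.negOnePow (p.1 + p.2) : ℤˣ) : ℤ) := by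
  obtain ⟨L0, hL0⟩ := aux_cong (n + 1)
  refine ⟨L0 + n + 1, by omega, ?_⟩
  have h := hL0 (L0 + n + 1) (by omega) _ rfl
  set L := L0 + n + 1
  rw [X_pow_dvd_iff] at h
  have h := h n (by omega)
  rw [coeff_sub, sub_eq_zero] at h
  simp only [map_sum, map_mul, expand_C, map_pow, expand_X, ← pow_mul] at h
  rw [Finset.sum_mul_sum, Finset.sum_mul_sum, ← Finset.sum_product', ← Finset.sum_product',
    finsetSum_coeff, finsetSum_coeff] at h
  have e : ∀ (x y : ℤ) (i j : ℕ), (C ((Int.negOnePow x : ℤˣ) : ℤ) * X ^ i *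
      (C ((Int.negOnePow y : ℤˣ) : ℤ) * X ^ j)).coeff n =
      if i + j = n then ((Int.negOnePow (x + y) : ℤˣ) : ℤ) else 0 := by
    intro x y i j
    rw [show C ((Int.negOnePow x : ℤˣ) : ℤ) * X ^ i * (C ((Int.negOnePow y : ℤˣ) : ℤ) * X ^ j) =
      C (((Int.negOnePow (x + y) : ℤˣ) : ℤ)) * X ^ (i + j) by
        rw [Int.negOnePow_add, Units.val_mul, C_mul, pow_add]; ring]
    rw [coeff_C_mul, coeff_X_pow]
    by_cases hh : i + j = n
    · simp [hh]
    · rw [if_neg hh, if_neg (Ne.symm hh), mul_zero]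
  simp only [e] at h
  rw [Finset.sum_filter, Finset.sum_filter]
  exact h

theorem aux_sign (D : Finset (ℤ × ℤ)) :
    ∑ p ∈ D, ((Int.negOnePow (p.1 + p.2) : ℤˣ) : ℤ) =
    ((D.filter fun p => (p.1 + p.2) % 2 = 0).card : ℤ) -
      ((D.filter fun p => (p.1 + p.2) % 2 = 1).card : ℤ) := by
  rw [Finset.card_filter, Finset.card_filter]
  push_cast
  rw [← Finset.sum_sub_distrib]
  refine Finset.sum_congr rfl fun p _ => ?_
  rcases Int.emod_two_eq_zero_or_one (p.1 + p.2) with h | h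
  · rw [Int.negOnePow_even _ (Int.even_iff.2 h)]; simp [h]
  · rw [Int.negOnePow_odd _ (Int.odd_iff.2 h)]; simp [h]

theorem aux_pent_sq (k : ℤ) : 24 * (pentagonal k : ℤ) + 1 = (6 * k - 1) ^ 2 := by
  linear_combination 12 * two_mul_natCast_pentagonal k

theorem aux_tri_sq (j : ℤ) : 8 * (auxTri j : ℤ) + 1 = (4 * j + 1) ^ 2 := by
  linear_combination 8 * auxTri_cast j

theorem aux_pent_bd (k : ℤ) : -(pentagonal k : ℤ) ≤ k ∧ k ≤ pentagonal k := by
  have h := two_mul_natCast_pentagonal k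
  constructor
  · nlinarith
  · rcases le_or_gt k 0 with h0 | h0
    · omega
    · nlinarith

theorem aux_tri_bd (j : ℤ) : -(auxTri j : ℤ) ≤ j ∧ j ≤ auxTri j := by
  have h := auxTri_cast j
  constructor
  · nlinarith
  · nlinarith [sq_nonneg j]

/-- `±(6k-1)`, normalised to be `1` or `5` modulo `12`. -/
def auxG (k : ℤ) : ℤ := if k % 2 = 0 then 1 - 6 * k else 6 * k - 1

/-- `±(4j+1)` with the sign `(-1)^k`. -/
def auxH (k j : ℤ) : ℤ := if k % 2 = 0 then 4 * j + 1 else -(4 * j + 1)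

theorem auxG_sq (k : ℤ) : auxG k ^ 2 = 24 * (pentagonal k : ℤ) + 1 := by
  rw [aux_pent_sq]; unfold auxG; split_ifs <;> ring

theorem auxH_sq (k j : ℤ) : auxH k j ^ 2 = 8 * (auxTri j : ℤ) + 1 := by
  rw [aux_tri_sq]; unfold auxH; split_ifs <;> ring

/-- The index set on the `ℚ(√-6)` side. -/
noncomputable def auxD (n L : ℕ) : Finset (ℤ × ℤ) :=
  (Finset.Ico (-L : ℤ) L ×ˢ Finset.Ico (-L : ℤ) L).filter
    fun p => 2 * pentagonal p.1 + auxTri p.2 = n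

/-- The index set on the `ℚ(i)` side. -/
noncomputable def auxC (n L : ℕ) : Finset (ℤ × ℤ) :=
  (Finset.Ico (-L : ℤ) L ×ˢ Finset.Ico (-L : ℤ) L).filter
    fun p => pentagonal p.1 + 4 * pentagonal p.2 = n

theorem mem_auxD {n L : ℕ} (h : n < L) (k j : ℤ) :
    (k, j) ∈ auxD n L ↔ 2 * (3 * auxH k j) ^ 2 + 3 * (12 * k - 2) ^ 2 = 144 * (n : ℤ) + 30 := by
  have h1 := aux_pent_bd k
  have h2 := aux_tri_bd j
  have h3 := auxH_sq k j
  have h4 := aux_pent_sq k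
  have e : 2 * (3 * auxH k j) ^ 2 + 3 * (12 * k - 2) ^ 2 =
      144 * (2 * (pentagonal k : ℤ) + auxTri j) + 30 := by
    linear_combination 18 * h3 - 12 * h4
  rw [e]
  simp only [auxD, Finset.mem_filter, Finset.mem_product, Finset.mem_Ico]
  omega

theorem mem_auxC {n L : ℕ} (h : n < L) (k l : ℤ) :
    (k, l) ∈ auxC n L ↔ (2 * auxG l) ^ 2 + auxG k ^ 2 = 24 * (n : ℤ) + 5 := by
  have h1 := aux_pent_bd k
  have h2 := aux_pent_bd l
  rw [mul_pow, auxG_sq, auxG_sq]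
  simp only [auxC, Finset.mem_filter, Finset.mem_product, Finset.mem_Ico]
  omega

theorem auxC_card {n L : ℕ} (hn : n < L) (r : ℤ) (Q : ℤ → ℤ → Prop)
    (hQ : ∀ x y, Q x y ↔ ∃ k l, (k + l) % 2 = r ∧ x = 2 * auxG l ∧ y = auxG k) :
    {p : ℤ × ℤ | p.1 ^ 2 + p.2 ^ 2 = 24 * n + 5 ∧ Q p.1 p.2}.ncard =
      ((auxC n L).filter fun p => (p.1 + p.2) % 2 = r).card := by
  have hinj : Function.Injective fun p : ℤ × ℤ => (2 * auxG p.2, auxG p.1) := by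
    rintro ⟨a, b⟩ ⟨c, d⟩ h
    simp only [Prod.mk.injEq, auxG] at h ⊢
    split_ifs at h <;> omega
  set D := (auxC n L).filter fun p => (p.1 + p.2) % 2 = r with hD
  rw [← Set.ncard_coe_finset D, ← Set.ncard_image_of_injective (D : Set (ℤ × ℤ)) hinj]
  congr 1
  ext ⟨x, y⟩
  simp only [Set.mem_ofPred_eq, Set.mem_image, hD, Finset.coe_filter, Prod.exists, Prod.mk.injEq, hQ]
  constructor
  · rintro ⟨h, k, l, hr, rfl, rfl⟩
    exact ⟨k, l, ⟨(mem_auxC hn k l).2 h, hr⟩, rfl, rfl⟩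
  · rintro ⟨k, l, ⟨h, hr⟩, rfl, rfl⟩
    exact ⟨(mem_auxC hn k l).1 h, k, l, hr, rfl, rfl⟩

theorem auxD_card {n L : ℕ} (hn : n < L) (r : ℤ) (Q : ℤ → ℤ → Prop)
    (hQ : ∀ x y, Q x y ↔ ∃ k j, (k + j) % 2 = r ∧ x = 3 * auxH k j ∧
      (y = 12 * k - 2 ∨ y = -(12 * k - 2))) :
    {p : ℤ × ℤ | 2 * p.1 ^ 2 + 3 * p.2 ^ 2 = 144 * n + 30 ∧ Q p.1 p.2}.ncard =
      2 * ((auxD n L).filter fun p => (p.1 + p.2) % 2 = r).card := by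
  have hinj1 : Function.Injective fun p : ℤ × ℤ => (3 * auxH p.1 p.2, 12 * p.1 - 2) := by
    rintro ⟨a, b⟩ ⟨c, d⟩ h
    simp only [Prod.mk.injEq, auxH] at h ⊢
    split_ifs at h <;> omega
  have hinj2 : Function.Injective fun p : ℤ × ℤ => (3 * auxH p.1 p.2, -(12 * p.1 - 2)) := by
    rintro ⟨a, b⟩ ⟨c, d⟩ h
    simp only [Prod.mk.injEq, auxH] at h ⊢
    split_ifs at h <;> omega
  set D := (auxD n L).filter fun p => (p.1 + p.2) % 2 = r with hD
  have hunion : {p : ℤ × ℤ | 2 * p.1 ^ 2 + 3 * p.2 ^ 2 = 144 * n + 30 ∧ Q p.1 p.2} =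
      ((fun p : ℤ × ℤ => (3 * auxH p.1 p.2, 12 * p.1 - 2)) '' (D : Set (ℤ × ℤ))) ∪
      ((fun p : ℤ × ℤ => (3 * auxH p.1 p.2, -(12 * p.1 - 2))) '' (D : Set (ℤ × ℤ))) := by
    ext ⟨x, y⟩
    simp only [Set.mem_ofPred_eq, Set.mem_image, Set.mem_union, hD, Finset.coe_filter, Prod.exists,
      Prod.mk.injEq, hQ]
    constructor
    · rintro ⟨h, k, j, hr, rfl, rfl | rfl⟩
      · exact Or.inl ⟨k, j, ⟨(mem_auxD hn k j).2 h, hr⟩, rfl, rfl⟩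
      · rw [neg_sq] at h
        exact Or.inr ⟨k, j, ⟨(mem_auxD hn k j).2 h, hr⟩, rfl, rfl⟩
    · rintro (⟨k, j, ⟨h, hr⟩, rfl, rfl⟩ | ⟨k, j, ⟨h, hr⟩, rfl, rfl⟩)
      · exact ⟨(mem_auxD hn k j).1 h, k, j, hr, rfl, Or.inl rfl⟩
      · refine ⟨?_, k, j, hr, rfl, Or.inr rfl⟩
        rw [neg_sq]
        exact (mem_auxD hn k j).1 h
  have hdisj : Disjoint
      ((fun p : ℤ × ℤ => (3 * auxH p.1 p.2, 12 * p.1 - 2)) '' (D : Set (ℤ × ℤ)))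
      ((fun p : ℤ × ℤ => (3 * auxH p.1 p.2, -(12 * p.1 - 2))) '' (D : Set (ℤ × ℤ))) := by
    rw [Set.disjoint_left]
    rintro _ ⟨⟨a, b⟩, _, rfl⟩ ⟨⟨c, d⟩, _, h⟩
    simp only [Prod.mk.injEq] at h
    omega
  rw [hunion, Set.ncard_union_eq hdisj (D.finite_toSet.image _) (D.finite_toSet.image _),
    Set.ncard_image_of_injective _ hinj1, Set.ncard_image_of_injective _ hinj2,
    Set.ncard_coe_finset]
  ring

theorem auxG_iff (r x y : ℤ) : (∃ k l, (k + l) % 2 = r ∧ x = 2 * auxG l ∧ y = auxG k) ↔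
    ((r = 0 ∧ ((x % 24 = 2 ∧ y % 12 = 1) ∨ (x % 24 = 10 ∧ y % 12 = 5))) ∨
     (r = 1 ∧ ((x % 24 = 2 ∧ y % 12 = 5) ∨ (x % 24 = 10 ∧ y % 12 = 1)))) := by
  constructor
  · rintro ⟨k, l, h, rfl, rfl⟩
    unfold auxG
    split_ifs <;> omega
  · intro h
    refine ⟨if y % 12 = 1 then (1 - y) / 6 else (y + 1) / 6,
      if x % 24 = 2 then (2 - x) / 12 else (x + 2) / 12, ?_⟩
    unfold auxG
    split_ifs <;> omega

theorem auxH_iff (r x y : ℤ) : (∃ k j, (k + j) % 2 = r ∧ x = 3 * auxH k j ∧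
      (y = 12 * k - 2 ∨ y = -(12 * k - 2))) ↔
    ((r = 0 ∧ ((x % 24 = 3 ∧ y % 24 = 2) ∨ (x % 24 = 3 ∧ y % 24 = 22) ∨
        (x % 24 = 9 ∧ y % 24 = 10) ∨ (x % 24 = 9 ∧ y % 24 = 14))) ∨
     (r = 1 ∧ ((x % 24 = 15 ∧ y % 24 = 2) ∨ (x % 24 = 15 ∧ y % 24 = 22) ∨
        (x % 24 = 21 ∧ y % 24 = 10) ∨ (x % 24 = 21 ∧ y % 24 = 14)))) := by
  constructor
  · rintro ⟨k, j, h, rfl, hy⟩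
    have hk : k % 2 = 0 ∨ k % 2 = 1 := by omega
    have hr : r = 0 ∨ r = 1 := by omega
    unfold auxH
    rcases hk with hk | hk <;> rcases hr with rfl | rfl
    · left
      rw [if_pos hk]
      have : 3 * (4 * j + 1) % 24 = 3 := by omega
      have hy' : y % 24 = 2 ∨ y % 24 = 22 := by omega
      rcases hy' with hy' | hy' <;> rw [this, hy'] <;> simp
    · right
      rw [if_pos hk]
      have : 3 * (4 * j + 1) % 24 = 15 := by omega
      have hy' : y % 24 = 2 ∨ y % 24 = 22 := by omega
      rcases hy' with hy' | hy' <;> rw [this, hy'] <;> simp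
    · left
      rw [if_neg (by omega)]
      have : 3 * -(4 * j + 1) % 24 = 9 := by omega
      have hy' : y % 24 = 10 ∨ y % 24 = 14 := by omega
      rcases hy' with hy' | hy' <;> rw [this, hy'] <;> simp
    · right
      rw [if_neg (by omega)]
      have : 3 * -(4 * j + 1) % 24 = 21 := by omega
      have hy' : y % 24 = 10 ∨ y % 24 = 14 := by omega
      rcases hy' with hy' | hy' <;> rw [this, hy'] <;> simp
  · intro h
    refine ⟨if y % 12 = 10 then (y + 2) / 12 else (2 - y) / 12,
      if x % 12 = 3 then (x - 3) / 12 else (-x - 3) / 12, ?_⟩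
    unfold auxH
    rcases h with ⟨rfl, h⟩ | ⟨rfl, h⟩ <;> rcases h with h | h | h | h <;>
      obtain ⟨h1, h2⟩ := h <;> split_ifs <;> omega

/-- The two quadratic-form expressions for the coefficients of `ρ*` agree:
the signed count of representations `2x² + 3y² = 144n + 30` with congruence
conditions mod `24` (from `ℚ(√-6)`) equals twice the signed count of
representations `x² + y² = 24n + 5` with the indicated congruence conditions
(from `ℚ(i)`). -/
theorem stmt_13 (n : ℕ) :
    (({p : ℤ × ℤ | 2 * p.1 ^ 2 + 3 * p.2 ^ 2 = 144 * n + 30 ∧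
        (p.1 % 24, p.2 % 24) ∈
          ({(3, 2), (3, 22), (9, 10), (9, 14)} : Set (ℤ × ℤ))}.ncard : ℤ)) -
    (({p : ℤ × ℤ | 2 * p.1 ^ 2 + 3 * p.2 ^ 2 = 144 * n + 30 ∧
        (p.1 % 24, p.2 % 24) ∈
          ({(15, 2), (15, 22), (21, 10), (21, 14)} : Set (ℤ × ℤ))}.ncard : ℤ)) =
    2 * ((({p : ℤ × ℤ | p.1 ^ 2 + p.2 ^ 2 = 24 * n + 5 ∧
        ((p.1 % 24 = 2 ∧ p.2 % 12 = 1) ∨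
         (p.1 % 24 = 10 ∧ p.2 % 12 = 5))}.ncard : ℤ)) -
      (({p : ℤ × ℤ | p.1 ^ 2 + p.2 ^ 2 = 24 * n + 5 ∧
        ((p.1 % 24 = 2 ∧ p.2 % 12 = 5) ∨
         (p.1 % 24 = 10 ∧ p.2 % 12 = 1))}.ncard : ℤ))) := by

  obtain ⟨L, hL, h⟩ := aux_coeff n
  rw [aux_sign, aux_sign] at h
  have a0 := auxD_card hL 0 (fun x y => (x % 24, y % 24) ∈
          ({(3, 2), (3, 22), (9, 10), (9, 14)} : Set (ℤ × ℤ)))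
          (fun x y => by rw [auxH_iff]; simp)
  have a1 := auxD_card hL 1 (fun x y => (x % 24, y % 24) ∈
          ({(15, 2), (15, 22), (21, 10), (21, 14)} : Set (ℤ × ℤ)))
          (fun x y => by rw [auxH_iff]; simp)
  have c0 := auxC_card hL 0 (fun x y => (x % 24 = 2 ∧ y % 12 = 1) ∨ (x % 24 = 10 ∧ y % 12 = 5))
          (fun x y => by rw [auxG_iff]; simp)
  have c1 := auxC_card hL 1 (fun x y => (x % 24 = 2 ∧ y % 12 = 5) ∨ (x % 24 = 10 ∧ y % 12 = 1))
          (fun x y => by rw [auxG_iff]; simp)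
  rw [a0, a1, c0, c1]
  unfold auxD auxC
  push_cast
  linear_combination 2 * h
end

section
/- There exists a cusp form f of weight 1 for the congruence subgroup Γ₁(2304) such that for every τ in the complex upper half-plane, f(τ) = q · ∏_{n≥1} (1 - q^{48n})^8 / ( (1 - q^{24n})^3 (1 - q^{96n})^3 ), where q = e^{2πiτ}. (Equivalently, the eta quotient η(48τ)^8 / (η(24τ)^3 η(96τ)^3) is a weight 1 cusp form on Γ₁(2304), and it equals q·ρ(q^{24}).) -/
open Real Complex

namespace EtaQuot

section helpers

open ModularForm UpperHalfPlane Filter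
open scoped MatrixGroups ModularForm Topology Manifold

/-- Exponent (in units of `1/48`) of the multiplier of `η(z)^3/η(2z)` on `Γ₀(2)`,
for the matrix `(a b; 2c d)`. -/
def EE (a b c d : ℤ) : ℤ :=
  10 * c * (a + d) - 2 * b * d * (10 * c ^ 2 - 1) + 12 * (d - 1) - 30 * c * d + 3 * (d ^ 2 - 1)

lemma dvd_twelve {x : ℤ} (h3 : (x : ZMod 3) = 0) (h4 : (x : ZMod 4) = 0) : (12 : ℤ) ∣ x := by
  have h3' := (ZMod.intCast_zmod_eq_zero_iff_dvd x 3).1 h3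
  have h4' := (ZMod.intCast_zmod_eq_zero_iff_dvd x 4).1 h4
  push_cast at h3' h4'
  omega

lemma EE_T {a b c d : ℤ} (h : a * d - b * (2 * c) = 1) :
    (48 : ℤ) ∣ EE a (a + b) c (2 * c + d) - EE a b c d - 2 := by
  have key : (12 : ℤ) ∣ -12*c^2 - 20*b*c^3 + 2*b*c - 10*a*c^3 + a*c + 6*c + 3*c*d := by
    have h3 := congrArg (Int.cast : ℤ → ZMod 3) h
    have h4 := congrArg (Int.cast : ℤ → ZMod 4) h
    apply dvd_twelve
    · push_cast at h3 ⊢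
      generalize (a : ZMod 3) = a at *
      generalize (b : ZMod 3) = b at *
      generalize (c : ZMod 3) = c at *
      generalize (d : ZMod 3) = d at *
      revert a b c d
      decide
    · push_cast at h4 ⊢
      generalize (a : ZMod 4) = a at *
      generalize (b : ZMod 4) = b at *
      generalize (c : ZMod 4) = c at *
      generalize (d : ZMod 4) = d at *
      revert a b c d
      decide
  obtain ⟨k, hk⟩ := key
  refine ⟨k, ?_⟩
  unfold EE
  linear_combination 4 * hk + (-2 * (10 * c ^ 2 - 1)) * h

lemma EE_V {a b c d : ℤ} (h : a * d - b * (2 * c) = 1) :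
    (48 : ℤ) ∣ EE (a + 2 * b) b (c + d) d - EE a b c d + 10 := by
  have key : (12 : ℤ) ∣ 5 * (1 - d ^ 2) * (1 + 2 * b * c + b * d) := by
    have h3 := congrArg (Int.cast : ℤ → ZMod 3) h
    have h4 := congrArg (Int.cast : ℤ → ZMod 4) h
    apply dvd_twelve
    · push_cast at h3 ⊢
      generalize (a : ZMod 3) = a at *
      generalize (b : ZMod 3) = b at *
      generalize (c : ZMod 3) = c at *
      generalize (d : ZMod 3) = d at *
      revert a b c d
      decide
    · push_cast at h4 ⊢
      generalize (a : ZMod 4) = a at *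
      generalize (b : ZMod 4) = b at *
      generalize (c : ZMod 4) = c at *
      generalize (d : ZMod 4) = d at *
      revert a b c d
      decide
  obtain ⟨k, hk⟩ := key
  refine ⟨k, ?_⟩
  unfold EE
  linear_combination 4 * hk + 10 * h

/-- `e(1/48)`. -/
noncomputable def ze : ℂ := Complex.exp (2 * Real.pi * Complex.I / 48)

lemma ze_ne : ze ≠ 0 := Complex.exp_ne_zero _

lemma ze_zpow (n : ℤ) : ze ^ n = Complex.exp (2 * Real.pi * Complex.I * n / 48) := by
  rw [ze, ← Complex.exp_int_mul]
  ring_nf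

lemma ze_zpow_dvd {n : ℤ} (h : (48 : ℤ) ∣ n) : ze ^ n = 1 := by
  obtain ⟨k, rfl⟩ := h
  rw [ze_zpow, ← Complex.exp_int_mul_two_pi_mul_I k]
  push_cast
  ring_nf

lemma ze_congr {m n : ℤ} (h : (48 : ℤ) ∣ m - n) : ze ^ m = ze ^ n := by
  have := ze_zpow_dvd h
  rw [zpow_sub₀ ze_ne] at this
  field_simp [zpow_ne_zero _ ze_ne] at this
  exact this

lemma eta_add_int (z : ℂ) (n : ℤ) : η (z + n) = ze ^ (2 * n) * η z := by
  unfold ModularForm.eta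
  have h1 : Function.Periodic.qParam 24 (z + n) = ze ^ (2 * n) * Function.Periodic.qParam 24 z := by
    rw [ze_zpow, Function.Periodic.qParam, Function.Periodic.qParam, ← Complex.exp_add]
    congr 1
    push_cast
    ring
  have h2 : Function.Periodic.qParam 1 (z + n) = Function.Periodic.qParam 1 z := by
    rw [Function.Periodic.qParam, Function.Periodic.qParam]
    rw [← Complex.exp_periodic.int_mul n (2 * Real.pi * Complex.I * z / ((1 : ℝ) : ℂ))]
    congr 1
    push_cast
    ring
  simp only [eta_q, h1, h2]
  ring

lemma eta_S {z : ℂ} (hz : 0 < z.im) :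
    η (-1 / z) = (Complex.sqrt Complex.I)⁻¹ * (Complex.sqrt z * η z) := by
  simpa using eta_comp_eq_csqrt_I_inv (x := z) hz

/-- `η(z)^3/η(2z)`. -/
noncomputable def hh (z : ℍ) : ℂ := η z ^ 3 / η (2 * z)

/-- `η(z)^3/η(z/2)`. -/
noncomputable def kk (z : ℍ) : ℂ := η z ^ 3 / η (z / 2)

lemma hh_of_coe {w z : ℍ} {n : ℤ} (h : (w : ℂ) = z + n) : hh w = ze ^ (2 * n) * hh z := by
  have e2 : (2 : ℂ) * w = 2 * z + ((2 * n : ℤ) : ℂ) := by rw [h]; push_cast; ring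
  unfold hh
  rw [e2, h, eta_add_int, eta_add_int, mul_pow]
  have e : (ze ^ (2 * n)) ^ 3 = ze ^ (2 * n) * ze ^ (2 * (2 * n)) := by
    rw [← zpow_natCast, ← zpow_mul, ← zpow_add₀ ze_ne]
    congr 1
    push_cast; ring
  rw [e]
  have := zpow_ne_zero (2 * (2 * n)) ze_ne
  field_simp

lemma kk_of_coe {w z : ℍ} {n : ℤ} (h : (w : ℂ) = z + ((2 * n : ℤ) : ℂ)) :
    kk w = ze ^ (10 * n) * kk z := by
  have e2 : (w : ℂ) / 2 = z / 2 + (n : ℂ) := by rw [h]; push_cast; ring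
  unfold kk
  rw [e2, h, eta_add_int, eta_add_int, mul_pow]
  have e : (ze ^ (2 * (2 * n))) ^ 3 = ze ^ (10 * n) * ze ^ (2 * n) := by
    rw [← zpow_natCast, ← zpow_mul, ← zpow_add₀ ze_ne]
    congr 1
    push_cast; ring
  rw [e]
  have := zpow_ne_zero (2 * n) ze_ne
  field_simp

lemma hh_S : ∃ C : ℂ, C ≠ 0 ∧ hh ∣[(1 : ℤ)] ModularGroup.S = C • kk := by
  have hI : Complex.sqrt Complex.I ≠ 0 := by simp [Complex.sqrt]
  have h2 : Complex.sqrt (1 / 2) ≠ 0 := by simp [Complex.sqrt]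
  refine ⟨(Complex.sqrt Complex.I)⁻¹ ^ 2 / Complex.sqrt (1 / 2), by positivity, ?_⟩
  ext z
  have hz0 : (z : ℂ) ≠ 0 := z.ne_zero
  have hz2 : 0 < ((z : ℂ) / 2).im := by
    have := z.im_pos
    simp only [Complex.div_ofNat_im, coe_im]
    linarith
  have e1 := eta_S z.im_pos
  have e2 := eta_S hz2
  have s1 : Complex.sqrt (z / 2) = Complex.sqrt (1 / 2) * Complex.sqrt z := by
    have hl : Complex.log ((z : ℂ) / 2) = Complex.log (1 / 2) + Complex.log z := by
      have := Complex.log_ofReal_mul (r := 1 / 2) (by norm_num) hz0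
      rw [Complex.ofReal_log (by norm_num)] at this
      push_cast at this
      rw [← this]
      congr 1
      ring
    rw [Complex.sqrt, Complex.sqrt, Complex.sqrt, Complex.cpow_def_of_ne_zero (by simpa using hz0),
      Complex.cpow_def_of_ne_zero (by norm_num), Complex.cpow_def_of_ne_zero hz0,
      ← Complex.exp_add, hl]
    congr 1
    ring
  have s2 : Complex.sqrt z ^ 2 = z := by
    rw [Complex.sqrt]
    exact Complex.cpow_nat_inv_pow _ (by norm_num)
  have s0 : Complex.sqrt z ≠ 0 := by simp [Complex.sqrt, hz0]
  rw [SL_slash_apply, UpperHalfPlane.modular_S_smul]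
  have hne := eta_ne_zero z.im_pos
  have hne2 := eta_ne_zero hz2
  have c1 : (-(z : ℂ))⁻¹ = -1 / z := by rw [inv_neg, neg_div, one_div]
  have c2 : 2 * (-(z : ℂ))⁻¹ = -1 / (z / 2) := by field_simp
  simp only [hh, kk, Pi.smul_apply, smul_eq_mul]
  rw [c2, c1, e1, e2, s1, ModularGroup.denom_S, zpow_neg_one]
  field_simp
  rw [s2]

lemma T_hh (n : ℤ) : hh ∣[(1 : ℤ)] (ModularGroup.T ^ n) = ze ^ (2 * n) • hh := by
  ext z
  rw [SL_slash_apply, Pi.smul_apply, smul_eq_mul, hh_of_coe (z := z) (n := n)]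
  · rw [ModularGroup.denom_apply, ModularGroup.coe_T_zpow]
    simp
  · rw [UpperHalfPlane.modular_T_zpow_smul, UpperHalfPlane.coe_vadd]
    push_cast
    ring

lemma T_kk (n : ℤ) : kk ∣[(1 : ℤ)] (ModularGroup.T ^ (2 * n)) = ze ^ (10 * n) • kk := by
  ext z
  rw [SL_slash_apply, Pi.smul_apply, smul_eq_mul, kk_of_coe (z := z) (n := n)]
  · rw [ModularGroup.denom_apply, ModularGroup.coe_T_zpow]
    simp
  · rw [UpperHalfPlane.modular_T_zpow_smul, UpperHalfPlane.coe_vadd]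
    push_cast
    ring

lemma hh_V : hh ∣[(1 : ℤ)] (ModularGroup.S * ModularGroup.T ^ (2 * (-1 : ℤ)) * ModularGroup.S⁻¹)
    = ze ^ (-10 : ℤ) • hh := by
  obtain ⟨C, hC, h⟩ := hh_S
  have h' : kk ∣[(1 : ℤ)] ModularGroup.S⁻¹ = C⁻¹ • hh := by
    have := congrArg (fun f => f ∣[(1 : ℤ)] ModularGroup.S⁻¹) h
    simp only [← SlashAction.slash_mul, mul_inv_cancel, SlashAction.slash_one,
      SL_smul_slash] at this
    rw [this, smul_smul, inv_mul_cancel₀ hC, one_smul]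
  rw [SlashAction.slash_mul, SlashAction.slash_mul, h, SL_smul_slash, T_kk, SL_smul_slash,
    SL_smul_slash, h', smul_smul, smul_smul]
  congr 1
  field_simp
  norm_num

/-- The matrix `(a b; 2c d)`. -/
def gm (a b c d : ℤ) (h : a * d - b * (2 * c) = 1) : SL(2, ℤ) :=
  ⟨!![a, b; 2 * c, d], by rw [Matrix.det_fin_two_of]; exact h⟩

/-- The transformation property. -/
def PP (a b c d : ℤ) : Prop :=
  ∀ h : a * d - b * (2 * c) = 1, hh ∣[(1 : ℤ)] (gm a b c d h) = ze ^ (EE a b c d) • hh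

lemma step_T {a b c d : ℤ} : PP a b c d ↔ PP a (a + b) c (2 * c + d) := by
  have hm : ∀ h h', gm a (a + b) c (2 * c + d) h' = gm a b c d h * ModularGroup.T ^ (1 : ℤ) := by
    intro h h'
    ext i j
    rw [Matrix.SpecialLinearGroup.coe_mul, ModularGroup.coe_T_zpow]
    fin_cases i <;> fin_cases j <;> simp [gm, Matrix.mul_apply, Fin.sum_univ_two]
  have hiff : (a * d - b * (2 * c) = 1) ↔ a * (2 * c + d) - (a + b) * (2 * c) = 1 := by
    constructor <;> intro h <;> linarith
  constructor
  · intro hP h'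
    have h := hiff.2 h'
    rw [hm h h', SlashAction.slash_mul, hP h, SL_smul_slash, T_hh, smul_smul, ← zpow_add₀ ze_ne]
    congr 1
    apply ze_congr
    have := EE_T h
    omega
  · intro hP h
    have h' := hiff.1 h
    have e : gm a b c d h = gm a (a + b) c (2 * c + d) h' * ModularGroup.T ^ (-1 : ℤ) := by
      rw [hm h h']; group
    rw [e, SlashAction.slash_mul, hP h', SL_smul_slash, T_hh, smul_smul, ← zpow_add₀ ze_ne]
    congr 1
    apply ze_congr
    have := EE_T h
    omega

lemma V_inv : hh ∣[(1 : ℤ)]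
    (ModularGroup.S * ModularGroup.T ^ (2 * (-1 : ℤ)) * ModularGroup.S⁻¹)⁻¹
    = ze ^ (10 : ℤ) • hh := by
  have := congrArg (fun f => f ∣[(1 : ℤ)]
    (ModularGroup.S * ModularGroup.T ^ (2 * (-1 : ℤ)) * ModularGroup.S⁻¹)⁻¹) hh_V
  simp only [← SlashAction.slash_mul, mul_inv_cancel, SlashAction.slash_one,
      SL_smul_slash] at this
  nth_rewrite 2 [this]
  rw [smul_smul, ← zpow_add₀ ze_ne]
  norm_num

lemma step_V {a b c d : ℤ} : PP a b c d ↔ PP (a + 2 * b) b (c + d) d := by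
  have hm : ∀ h h', gm (a + 2 * b) b (c + d) d h' = gm a b c d h *
      (ModularGroup.S * ModularGroup.T ^ (2 * (-1 : ℤ)) * ModularGroup.S⁻¹) := by
    intro h h'
    ext i j
    have e : (ModularGroup.S * ModularGroup.T ^ (2 * (-1 : ℤ)) * ModularGroup.S⁻¹ : SL(2, ℤ)).1
      = !![1, 0; 2, 1] := by decide
    rw [Matrix.SpecialLinearGroup.coe_mul, e]
    fin_cases i <;> fin_cases j <;> simp [gm, Matrix.mul_apply, Fin.sum_univ_two] <;> ring
  have hiff : (a * d - b * (2 * c) = 1) ↔ (a + 2 * b) * d - b * (2 * (c + d)) = 1 := by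
    constructor <;> intro h <;> linarith
  constructor
  · intro hP h'
    have h := hiff.2 h'
    rw [hm h h', SlashAction.slash_mul, hP h, SL_smul_slash, hh_V, smul_smul, ← zpow_add₀ ze_ne]
    congr 1
    apply ze_congr
    have := EE_V h
    omega
  · intro hP h
    have h' := hiff.1 h
    have e : gm a b c d h = gm (a + 2 * b) b (c + d) d h' *
      (ModularGroup.S * ModularGroup.T ^ (2 * (-1 : ℤ)) * ModularGroup.S⁻¹)⁻¹ := by
      rw [hm h h']; group
    rw [e, SlashAction.slash_mul, hP h', SL_smul_slash, V_inv, smul_smul, ← zpow_add₀ ze_ne]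
    congr 1
    apply ze_congr
    have := EE_V h
    omega

lemma base_pos (b : ℤ) : PP 1 b 0 1 := by
  intro h
  have e : gm 1 b 0 1 h = ModularGroup.T ^ b := by
    ext i j
    rw [ModularGroup.coe_T_zpow]
    fin_cases i <;> fin_cases j <;> simp [gm]
  rw [e, T_hh]
  congr 2
  simp [EE]

lemma base_neg (b : ℤ) : PP (-1) b 0 (-1) := by
  intro h
  ext z
  rw [SL_slash_apply, Pi.smul_apply, smul_eq_mul, hh_of_coe (z := z) (n := -b),
    ModularGroup.denom_apply]
  · have e : EE (-1) b 0 (-1) = 2 * (-b) + (-24) := by unfold EE; ring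
    have e2 : ze ^ (-24 : ℤ) = -1 := by
      rw [ze_zpow, ← Complex.exp_neg_pi_mul_I]
      congr 1
      push_cast
      ring
    rw [e, zpow_add₀ ze_ne, e2]
    simp [gm]
  · rw [UpperHalfPlane.coe_specialLinearGroup_apply]
    simp [gm]
    ring

lemma all_PP : ∀ (n : ℕ) (a b c d : ℤ), (2 * c).natAbs + d.natAbs ≤ n → PP a b c d := by
  intro n
  induction n with
  | zero =>
    intro a b c d hn h
    have hc : c = 0 := by omega
    have hd : d = 0 := by omega
    subst hc hd
    simp at h
  | succ n ih =>
    intro a b c d hn h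
    have hd : d % 2 = 1 := by
      rcases Int.emod_two_eq_zero_or_one d with h0 | h1
      · exfalso
        obtain ⟨e, he⟩ := Int.dvd_of_emod_eq_zero h0
        have h2 : 2 * (a * e - b * c) = 1 := by rw [← h, he]; ring
        omega
      · exact h1
    revert h
    change PP a b c d
    by_cases hc : c = 0
    · subst hc
      intro h
      have h1 : a * d = 1 := by linarith
      rcases Int.eq_one_or_neg_one_of_mul_eq_one' h1 with ⟨rfl, rfl⟩ | ⟨rfl, rfl⟩
      · exact base_pos b h
      · exact base_neg b h
    · by_cases hlt : (2 * c).natAbs < d.natAbs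
      · by_cases hs : 0 < c * d
        · have h0 : (0 < c ∧ 0 < d) ∨ (c < 0 ∧ d < 0) := by
            rcases pos_and_pos_or_neg_and_neg_of_mul_pos hs with h | h <;> simp [h]
          have := step_T (a := a) (b := b - a) (c := c) (d := d - 2 * c)
          have e1 : a + (b - a) = b := by ring
          have e2 : 2 * c + (d - 2 * c) = d := by ring
          rw [e1, e2] at this
          exact this.1 (ih _ _ _ _ (by omega))
        · have h0 : (0 < c ∧ d < 0) ∨ (c < 0 ∧ 0 < d) := by
            have hd0 : d ≠ 0 := by omega
            have : c * d < 0 := lt_of_le_of_ne (not_lt.1 hs) (mul_ne_zero hc hd0)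
            rcases mul_neg_iff.1 this with h | h <;> simp [h]
          exact step_T.2 (ih _ _ _ _ (by omega))
      · by_cases hs : 0 < c * d
        · have h0 : (0 < c ∧ 0 < d) ∨ (c < 0 ∧ d < 0) := by
            rcases pos_and_pos_or_neg_and_neg_of_mul_pos hs with h | h <;> simp [h]
          have := step_V (a := a - 2 * b) (b := b) (c := c - d) (d := d)
          have e1 : a - 2 * b + 2 * b = a := by ring
          have e2 : c - d + d = c := by ring
          rw [e1, e2] at this
          exact this.1 (ih _ _ _ _ (by omega))
        · have h0 : (0 < c ∧ d < 0) ∨ (c < 0 ∧ 0 < d) := by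
            have hd0 : d ≠ 0 := by omega
            have : c * d < 0 := lt_of_le_of_ne (not_lt.1 hs) (mul_ne_zero hc hd0)
            rcases mul_neg_iff.1 this with h | h <;> simp [h]
          exact step_V.2 (ih _ _ _ _ (by omega))

lemma hh_gm (a b c d : ℤ) (h : a * d - b * (2 * c) = 1) :
    hh ∣[(1 : ℤ)] (gm a b c d h) = ze ^ (EE a b c d) • hh :=
  all_PP _ a b c d le_rfl h

/-- On the even-lower-left subgroup, `hh` is an eigenfunction. -/
lemma hh_even (γ : SL(2, ℤ)) (h : (2 : ℤ) ∣ γ 1 0) : ∃ C : ℂ, hh ∣[(1 : ℤ)] γ = C • hh := by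
  obtain ⟨c, hc⟩ := h
  have hdet := Matrix.det_fin_two γ.1
  rw [γ.2] at hdet
  have hd : γ 0 0 * γ 1 1 - γ 0 1 * (2 * c) = 1 := by rw [← hc]; exact hdet.symm
  refine ⟨ze ^ (EE (γ 0 0) (γ 0 1) c (γ 1 1)), ?_⟩
  rw [← hh_gm _ _ _ _ hd]
  congr 1
  ext i j
  fin_cases i <;> fin_cases j <;> simp [gm, hc]

/-- Euler's product. -/
noncomputable def P (q : ℂ) : ℂ := ∏' n : ℕ, (1 - q ^ (n + 1))

/-- Product over odd exponents. -/
noncomputable def Od (q : ℂ) : ℂ := ∏' n : ℕ, (1 - q ^ (2 * n + 1))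

lemma P_ne {q : ℂ} (hq : ‖q‖ < 1) : P q ≠ 0 := by
  refine tprod_one_add_ne_zero_of_summable (f := fun n : ℕ ↦ -q ^ (n + 1)) ?_ ?_
  · intro i h
    have h1 : q ^ (i + 1) = 1 := by linear_combination -h
    have h2 : ‖q‖ ^ (i + 1) = 1 := by rw [← norm_pow, h1, norm_one]
    have := pow_lt_one₀ (norm_nonneg q) hq (Nat.succ_ne_zero i)
    rw [Nat.succ_eq_add_one, h2] at this
    exact lt_irrefl _ this
  · simpa using (summable_nat_add_iff 1).mpr (summable_geometric_of_lt_one (norm_nonneg _) hq)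

lemma mult_Od {q : ℂ} (hq : ‖q‖ < 1) : Multipliable fun n : ℕ ↦ 1 - q ^ (2 * n + 1) := by
  apply multipliable_one_add_of_summable (f := fun n : ℕ ↦ -q ^ (2 * n + 1))
  have := (summable_nat_add_iff 1).mpr (summable_geometric_of_lt_one (norm_nonneg _) hq)
  have h2 := this.comp_injective (i := fun n : ℕ => 2 * n) (fun a b h => by simpa using h)
  simpa [Function.comp_def] using h2

lemma norm_sq_lt {q : ℂ} (hq : ‖q‖ < 1) : ‖q ^ 2‖ < 1 := by
  rw [norm_pow]
  exact pow_lt_one₀ (norm_nonneg q) hq two_ne_zero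

lemma P_split {q : ℂ} (hq : ‖q‖ < 1) : P q = Od q * P (q ^ 2) := by
  have h1 := mult_Od hq
  have h2 := multipliable_one_sub_pow (norm_sq_lt hq)
  have h3 : (fun k : ℕ => 1 - (q ^ 2) ^ (k + 1)) = fun k : ℕ => 1 - q ^ (2 * k + 1 + 1) := by
    ext k
    rw [← pow_mul]
    ring_nf
  have := tprod_even_mul_odd (f := fun n : ℕ => 1 - q ^ (n + 1)) h1 (h3 ▸ h2)
  rw [P, P, Od, h3, ← this]

lemma Od_mul {q : ℂ} (hq : ‖q‖ < 1) : Od q * Od (-q) = Od (q ^ 2) := by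
  rw [Od, Od, Od, ← (mult_Od hq).tprod_mul (mult_Od (by simpa using hq))]
  congr 1
  ext n
  rw [Odd.neg_pow ⟨n, rfl⟩, ← pow_mul, mul_comm 2 (2 * n + 1), pow_mul]
  ring

lemma P_id {q : ℂ} (hq : ‖q‖ < 1) : P (-q) * (P q * P (q ^ 4)) = P (q ^ 2) ^ 3 := by
  have e1 := P_split hq
  have e2 := P_split (q := -q) (by simpa using hq)
  have e3 := P_split (norm_sq_lt hq)
  have e4 := Od_mul hq
  rw [show (-q) ^ 2 = q ^ 2 by ring] at e2
  rw [show (q ^ 2) ^ 2 = q ^ 4 by ring, ← e4] at e3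
  rw [e2, e1]
  linear_combination -P (q ^ 2) ^ 2 * e3

lemma hasProd_P {q : ℂ} (hq : ‖q‖ < 1) : HasProd (fun n : ℕ => 1 - q ^ (n + 1)) (P q) :=
  (multipliable_one_sub_pow hq).hasProd

lemma prod_eq {q : ℂ} (hq : ‖q‖ < 1) :
    ∏' n : ℕ, ((1 - q ^ (2 * (n + 1))) ^ 8 / ((1 - q ^ (n + 1)) ^ 3 * (1 - q ^ (4 * (n + 1))) ^ 3))
      = P (-q) ^ 3 / P (q ^ 2) := by
  have hq2 := norm_sq_lt hq
  have hq4 : ‖q ^ 4‖ < 1 := by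
    have := norm_sq_lt hq2
    rwa [show (q ^ 2) ^ 2 = q ^ 4 by ring] at this
  have n1 := P_ne hq
  have n2 := P_ne hq2
  have n4 := P_ne hq4
  have hd : P q ^ 3 * P (q ^ 4) ^ 3 ≠ 0 := mul_ne_zero (pow_ne_zero _ n1) (pow_ne_zero _ n4)
  have := (((hasProd_P hq2).pow 8).div₀ (((hasProd_P hq).pow 3).mul ((hasProd_P hq4).pow 3)) hd)
  refine Eq.trans (tprod_congr fun n => ?_) (this.tprod_eq.trans ?_)
  · simp only [Pi.div_apply, Pi.mul_apply, Pi.pow_apply, pow_mul]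
  · have e := P_id hq
    field_simp
    have e' : (P (-q) * (P q * P (q ^ 4))) ^ 3 = (P (q ^ 2) ^ 3) ^ 3 := by rw [e]
    linear_combination -e'

lemma eta_eq (z : ℂ) : η z = Complex.exp (2 * Real.pi * Complex.I * z / 24) *
    P (Complex.exp (2 * Real.pi * Complex.I * z)) := by
  unfold ModularForm.eta P
  simp [Function.Periodic.qParam, eta_q_eq_pow]

lemma hh_eq (z : ℍ) : hh z = Complex.exp (2 * Real.pi * Complex.I * z / 24) *
    (P (Complex.exp (2 * Real.pi * Complex.I * z)) ^ 3 /
      P (Complex.exp (2 * Real.pi * Complex.I * z) ^ 2)) := by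
  unfold hh
  rw [eta_eq, eta_eq]
  have e1 : Complex.exp (2 * Real.pi * Complex.I * (2 * z)) =
    Complex.exp (2 * Real.pi * Complex.I * z) ^ 2 := by
    rw [← Complex.exp_nat_mul]; congr 1; push_cast; ring
  have e2 : Complex.exp (2 * Real.pi * Complex.I * (2 * z) / 24) =
    Complex.exp (2 * Real.pi * Complex.I * z / 24) ^ 2 := by
    rw [← Complex.exp_nat_mul]; congr 1; push_cast; ring
  rw [e1, e2]
  have := Complex.exp_ne_zero (2 * Real.pi * Complex.I * z / 24)
  field_simp

lemma kk_eq (z : ℍ) : kk z = Complex.exp (2 * Real.pi * Complex.I * z / 48) ^ 5 *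
    (P (Complex.exp (2 * Real.pi * Complex.I * z / 2) ^ 2) ^ 3 /
      P (Complex.exp (2 * Real.pi * Complex.I * z / 2))) := by
  unfold kk
  rw [eta_eq, eta_eq]
  have e1 : Complex.exp (2 * Real.pi * Complex.I * z) =
    Complex.exp (2 * Real.pi * Complex.I * z / 2) ^ 2 := by
    rw [← Complex.exp_nat_mul]; congr 1; push_cast; ring
  have e2 : Complex.exp (2 * Real.pi * Complex.I * z / 24) =
    Complex.exp (2 * Real.pi * Complex.I * z / 48) ^ 2 := by
    rw [← Complex.exp_nat_mul]; congr 1; push_cast; ring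
  have e3 : Complex.exp (2 * Real.pi * Complex.I * (z / 2) / 24) =
    Complex.exp (2 * Real.pi * Complex.I * z / 48) := by
    congr 1; ring
  have e4 : Complex.exp (2 * Real.pi * Complex.I * (z / 2)) =
    Complex.exp (2 * Real.pi * Complex.I * z / 2) := by
    congr 1; ring
  rw [e1, e2, e3, e4]
  have := Complex.exp_ne_zero (2 * Real.pi * Complex.I * z / 48)
  field_simp

lemma P_tendsto : Tendsto P (𝓝 0) (𝓝 1) := by
  have h := (differentiableOn_tprod_one_sub_pow.differentiableAt
    (Metric.isOpen_ball.mem_nhds (Metric.mem_ball_self (x := (0 : ℂ)) one_pos))).continuousAt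
  have := h.tendsto
  simpa using! this

lemma exp_tendsto {h : ℝ} (hh0 : 0 < h) :
    Tendsto (fun z : ℍ => Complex.exp (2 * Real.pi * Complex.I * z / h)) atImInfty (𝓝 0) :=
  qParam_tendsto_atImInfty hh0

lemma hh_zero : IsZeroAtImInfty hh := by
  have t1 := exp_tendsto (h := 24) (by norm_num)
  have t2 := exp_tendsto (h := 1) (by norm_num)
  push_cast at t1 t2
  simp only [div_one] at t2
  have t3 : Tendsto (fun z : ℍ => Complex.exp (2 * Real.pi * Complex.I * z) ^ 2)
    atImInfty (𝓝 0) := by simpa using t2.pow 2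
  have := t1.mul (((P_tendsto.comp t2).pow 3).div (P_tendsto.comp t3) one_ne_zero)
  rw [zero_mul] at this
  exact this.congr fun z => (hh_eq z).symm

lemma kk_zero : IsZeroAtImInfty kk := by
  have t1 := exp_tendsto (h := 48) (by norm_num)
  have t2 := exp_tendsto (h := 2) (by norm_num)
  push_cast at t1 t2
  have t3 : Tendsto (fun z : ℍ => Complex.exp (2 * Real.pi * Complex.I * z / 2) ^ 2)
    atImInfty (𝓝 0) := by simpa using t2.pow 2
  have := (t1.pow 5).mul (((P_tendsto.comp t3).pow 3).div (P_tendsto.comp t2) one_ne_zero)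
  rw [zero_pow (by norm_num), zero_mul] at this
  exact this.congr fun z => (kk_eq z).symm

lemma smul_zero_at {f : ℍ → ℂ} (C : ℂ) (hf : IsZeroAtImInfty f) : IsZeroAtImInfty (C • f) := by
  have := Tendsto.const_mul C hf
  rw [mul_zero] at this
  exact this

lemma slash_T_zero {f : ℍ → ℂ} (hf : IsZeroAtImInfty f) :
    IsZeroAtImInfty (f ∣[(1 : ℤ)] ModularGroup.T) := by
  rw [SL_slash]
  refine hf.slash 1 ?_
  change ((ModularGroup.T 1 0 : ℤ) : ℝ) = 0
  simp [ModularGroup.T]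

lemma S_inv_coe : (ModularGroup.S⁻¹ : SL(2, ℤ)).1 = !![0, 1; -1, 0] := by decide

lemma T_inv_coe : (ModularGroup.T⁻¹ : SL(2, ℤ)).1 = !![1, -1; 0, 1] := by decide

lemma hh_slash_zero (γ : SL(2, ℤ)) : IsZeroAtImInfty (hh ∣[(1 : ℤ)] γ) := by
  by_cases hc : (2 : ℤ) ∣ γ 1 0
  · obtain ⟨C, hC⟩ := hh_even γ hc
    rw [hC]
    exact smul_zero_at C hh_zero
  obtain ⟨C', -, hS⟩ := hh_S
  by_cases hd : (2 : ℤ) ∣ γ 1 1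
  · obtain ⟨C, hC⟩ := hh_even (γ * ModularGroup.S⁻¹) (by
      rw [Matrix.SpecialLinearGroup.coe_mul, S_inv_coe]
      simpa [Matrix.mul_apply, Fin.sum_univ_two] using hd)
    have e : γ = γ * ModularGroup.S⁻¹ * ModularGroup.S := by group
    rw [e, SlashAction.slash_mul, hC, SL_smul_slash, hS]
    exact smul_zero_at _ (smul_zero_at _ kk_zero)
  · obtain ⟨C, hC⟩ := hh_even (γ * ModularGroup.T⁻¹ * ModularGroup.S⁻¹) (by
      rw [Matrix.SpecialLinearGroup.coe_mul, Matrix.SpecialLinearGroup.coe_mul, S_inv_coe,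
        T_inv_coe]
      simp [Matrix.mul_apply, Fin.sum_univ_two]
      omega)
    have e : γ = γ * ModularGroup.T⁻¹ * ModularGroup.S⁻¹ * ModularGroup.S * ModularGroup.T := by
      group
    rw [e, SlashAction.slash_mul, SlashAction.slash_mul, hC, SL_smul_slash, hS]
    exact slash_T_zero (smul_zero_at _ (smul_zero_at _ kk_zero))

lemma hh_isZeroAt {c : OnePoint ℝ} (hc : IsCusp c 𝒮ℒ) : c.IsZeroAt hh 1 := by
  rw [OnePoint.isZeroAt_iff_forall_SL2Z hc]
  exact fun γ _ => hh_slash_zero γ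

lemma hh_mdiff : MDiff hh := by
  rw [UpperHalfPlane.mdifferentiable_iff]
  have : DifferentiableOn ℂ (fun z : ℂ => η z ^ 3 / η (2 * z)) {z | 0 < z.im} := by
    intro z hz
    have hz2 : 2 * z ∈ upperHalfPlaneSet := by
      change 0 < (2 * z).im
      change 0 < z.im at hz
      simpa using hz
    apply DifferentiableAt.differentiableWithinAt
    refine ((differentiableAt_eta_of_mem_upperHalfPlaneSet hz).pow 3).div ?_ (eta_ne_zero hz2)
    exact (differentiableAt_eta_of_mem_upperHalfPlaneSet hz2).comp z (by fun_prop)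
  refine this.congr fun z hz => ?_
  simp [hh, ofComplex_apply_of_im_pos hz]

/-- The matrix `(24 1/2; 0 1)`. -/
noncomputable def A : GL (Fin 2) ℝ :=
  Matrix.GeneralLinearGroup.mkOfDetNeZero !![24, 1 / 2; 0, 1] (by simp [Matrix.det_fin_two])

lemma A_coe : (A : Matrix (Fin 2) (Fin 2) ℝ) = !![24, 1 / 2; 0, 1] := rfl

lemma A_det : (A.det : ℝ) = 24 := by
  rw [Matrix.GeneralLinearGroup.val_det_apply, A_coe]
  simp [Matrix.det_fin_two]

lemma A_smul (z : ℍ) : ((A • z : ℍ) : ℂ) = 24 * z + 1 / 2 := by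
  rw [UpperHalfPlane.coe_smul_of_det_pos (by rw [A_det]; norm_num)]
  simp [num, denom, A_coe]

lemma hh_A_apply (z : ℍ) : (hh ∣[(1 : ℤ)] A) z = hh (A • z) := by
  rw [slash_apply]
  simp [σ, A_det, denom, A_coe]

lemma A_cusp {c : OnePoint ℝ} (hc : IsCusp c 𝒮ℒ) : IsCusp (A • c) 𝒮ℒ := by
  rw [isCusp_SL2Z_iff] at hc ⊢
  obtain ⟨x, rfl⟩ := hc
  induction x using OnePoint.rec with
  | infty => exact ⟨OnePoint.infty, by simp [OnePoint.smul_infty_eq_ite, A_coe]⟩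
  | coe x =>
    refine ⟨((24 * x + 1 / 2 : ℚ) : OnePoint ℚ), ?_⟩
    rw [OnePoint.map_some, OnePoint.map_some, OnePoint.smul_some_eq_ite]
    simp [A_coe]

lemma mapGL_mat (γ : SL(2, ℤ)) : (Matrix.SpecialLinearGroup.mapGL ℝ γ).1 =
    !![((γ 0 0 : ℤ) : ℝ), ((γ 0 1 : ℤ) : ℝ); ((γ 1 0 : ℤ) : ℝ), ((γ 1 1 : ℤ) : ℝ)] := by
  ext i j
  fin_cases i <;> fin_cases j <;> rfl

lemma mapGL_gm (a b c d : ℤ) (h : a * d - b * (2 * c) = 1) :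
    (Matrix.SpecialLinearGroup.mapGL ℝ (gm a b c d h)).1 =
    !![(a : ℝ), (b : ℝ); ((2 * c : ℤ) : ℝ), (d : ℝ)] :=
  mapGL_mat _

lemma A_conj {γ : SL(2, ℤ)} (hγ : γ ∈ CongruenceSubgroup.Gamma1 2304) :
    hh ∣[(1 : ℤ)] (A * Matrix.SpecialLinearGroup.mapGL ℝ γ) = hh ∣[(1 : ℤ)] A := by
  rw [CongruenceSubgroup.Gamma1_mem] at hγ
  obtain ⟨ha, hd, hc⟩ := hγ
  obtain ⟨k, hk⟩ := (ZMod.intCast_zmod_eq_zero_iff_dvd _ _).1 hc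
  have ha' : ((γ 0 0 - 1 : ℤ) : ZMod 2304) = 0 := by push_cast; rw [ha]; ring
  have hd' : ((γ 1 1 - 1 : ℤ) : ZMod 2304) = 0 := by push_cast; rw [hd]; ring
  obtain ⟨m, hm⟩ := (ZMod.intCast_zmod_eq_zero_iff_dvd _ _).1 ha'
  obtain ⟨l, hl⟩ := (ZMod.intCast_zmod_eq_zero_iff_dvd _ _).1 hd'
  push_cast at hk hm hl
  have hm' : γ 0 0 = 1 + 2304 * m := by linarith
  have hl' : γ 1 1 = 1 + 2304 * l := by linarith
  have hdet := Matrix.det_fin_two γ.1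
  rw [γ.2, hm', hl', hk] at hdet
  have hdet' : (1 + 2304 * m + 48 * k) * (1 + 2304 * l - 48 * k) -
      (24 * γ 0 1 + 1152 * (l - m) - 24 * k) * (2 * (48 * k)) = 1 := by
    linear_combination -hdet
  have hconj : A * Matrix.SpecialLinearGroup.mapGL ℝ γ =
      Matrix.SpecialLinearGroup.mapGL ℝ (gm _ _ _ _ hdet') * A := by
    ext i j
    rw [Matrix.GeneralLinearGroup.coe_mul, Matrix.GeneralLinearGroup.coe_mul, A_coe, mapGL_gm, mapGL_mat]
    fin_cases i <;> fin_cases j <;>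
      simp [Matrix.mul_apply, Fin.sum_univ_two, hm', hl', hk] <;> ring
  have hE := hh_gm _ _ _ _ hdet'
  rw [ze_zpow_dvd, one_smul, SL_slash] at hE
  · rw [hconj, SlashAction.slash_mul]
    exact congrArg (fun f => f ∣[(1 : ℤ)] A) hE
  · unfold EE
    generalize γ 0 1 = b
    have h1 : (48 : ℤ) ∣ 48 * k := ⟨k, rfl⟩
    refine dvd_add (dvd_sub (dvd_add (dvd_sub ?_ ?_) ?_) ?_) ?_
    · exact ⟨10 * k * (1 + 2304 * m + 48 * k + (1 + 2304 * l - 48 * k)), by ring⟩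
    · exact ⟨(b + 48 * (l - m) - k) * (1 + 2304 * l - 48 * k) * (10 * (48 * k) ^ 2 - 1), by ring⟩
    · exact ⟨12 * (48 * l - k), by ring⟩
    · exact ⟨30 * k * (1 + 2304 * l - 48 * k), by ring⟩
    · exact ⟨3 * (48 * l - k) * (2 + 2304 * l - 48 * k), by ring⟩

lemma slash_smul_A (f : ℍ → ℂ) (C : ℂ) {g : GL (Fin 2) ℝ} (hg : 0 < g.det.val) :
    (C • f) ∣[(1 : ℤ)] g = C • (f ∣[(1 : ℤ)] g) := by
  rw [smul_slash, σ, if_pos hg]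
  rfl

/-- The cusp form. -/
noncomputable def F : CuspForm (CongruenceSubgroup.Gamma1 2304) 1 where
  toFun := ze⁻¹ • (hh ∣[(1 : ℤ)] A)
  slash_action_eq' := by
    rintro _ ⟨γ, hγ, rfl⟩
    rw [slash_smul_A _ _ (by simp), ← SlashAction.slash_mul, A_conj hγ]
  holo' := (hh_mdiff.slash 1 A).const_smul _
  zero_at_cusps' := by
    intro c hc
    rw [Subgroup.IsArithmetic.isCusp_iff_isCusp_SL2Z] at hc
    have h := OnePoint.IsZeroAt.smul_iff.1 (hh_isZeroAt (A_cusp hc))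
    rw [OnePoint.isZeroAt_iff_forall_SL2Z hc] at h ⊢
    intro γ hγ
    rw [SL_smul_slash]
    exact smul_zero_at _ (h γ hγ)

lemma F_apply (τ : ℍ) : F τ = ze⁻¹ * hh (A • τ) := by
  rw [← hh_A_apply]
  rfl

end helpers

end EtaQuot

/-- The eta quotient `η(48τ)⁸ / (η(24τ)³ η(96τ)³) = q ∏_{n≥1}
(1-q^{48n})⁸ / ((1-q^{24n})³ (1-q^{96n})³)` (with `q = e^{2πiτ}`) is a cusp
form of weight `1` for `Γ₁(2304)`; it equals `q·ρ(q²⁴)`. -/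
theorem stmt_14 :
    ∃ f : CuspForm (CongruenceSubgroup.Gamma1 2304) 1,
      ∀ τ : UpperHalfPlane,
        f τ = Complex.exp (2 * Real.pi * Complex.I * (τ : ℂ)) *
          ∏' n : ℕ,
            ((1 - Complex.exp (2 * Real.pi * Complex.I * (τ : ℂ)) ^ (48 * (n + 1))) ^ 8 /
              ((1 - Complex.exp (2 * Real.pi * Complex.I * (τ : ℂ)) ^ (24 * (n + 1))) ^ 3 *
               (1 - Complex.exp (2 * Real.pi * Complex.I * (τ : ℂ)) ^ (96 * (n + 1))) ^ 3)) := by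
  refine ⟨EtaQuot.F, fun τ => ?_⟩
  have hq : ‖Complex.exp (2 * Real.pi * Complex.I * (τ : ℂ)) ^ 24‖ < 1 := by
    rw [norm_pow]
    exact pow_lt_one₀ (norm_nonneg _) (UpperHalfPlane.norm_exp_two_pi_I_lt_one τ) (by norm_num)
  have hp := EtaQuot.prod_eq hq
  simp only [← pow_mul] at hp
  have e1 : ∀ n : ℕ, 24 * (2 * (n + 1)) = 48 * (n + 1) := fun n => by ring
  have e2 : ∀ n : ℕ, 24 * (4 * (n + 1)) = 96 * (n + 1) := fun n => by ring
  simp only [e1, e2] at hp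
  rw [hp, EtaQuot.F_apply, EtaQuot.hh_eq, EtaQuot.A_smul]
  have e3 : Complex.exp (2 * Real.pi * Complex.I * (24 * (τ : ℂ) + 1 / 2) / 24) =
      EtaQuot.ze * Complex.exp (2 * Real.pi * Complex.I * (τ : ℂ)) := by
    rw [EtaQuot.ze, ← Complex.exp_add]
    congr 1
    ring
  have e4 : Complex.exp (2 * Real.pi * Complex.I * (24 * (τ : ℂ) + 1 / 2)) =
      -Complex.exp (2 * Real.pi * Complex.I * (τ : ℂ)) ^ 24 := by
    rw [← Complex.exp_nat_mul, neg_eq_neg_one_mul, ← Complex.exp_pi_mul_I, ← Complex.exp_add]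
    congr 1
    push_cast
    ring
  rw [e3, e4, neg_sq, ← pow_mul, mul_assoc, inv_mul_cancel_left₀ EtaQuot.ze_ne]
end

section
/- There exists a modular form g of weight 1 for the congruence subgroup Γ₁(2304) such that for every τ in the complex upper half-plane, g(τ) = 2·Σ_{(x,y)∈T₊} e^{2πi(x²+y²)τ} - 2·Σ_{(x,y)∈T₋} e^{2πi(x²+y²)τ}, where T₊ = {(x,y) ∈ ℤ² : (x ≡ 2 (mod 24) and y ≡ 1 (mod 12)) or (x ≡ 10 (mod 24) and y ≡ 5 (mod 12))} and T₋ = {(x,y) ∈ ℤ² : (x ≡ 2 (mod 24) and y ≡ 5 (mod 12)) or (x ≡ 10 (mod 24) and y ≡ 1 (mod 12))}. (This function is q⁵ρ*(q^{24}), the part of the threefield theta series supported on exponents ≡ 5 mod 24.) -/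
/-- The congruence conditions defining the positive part of `ρ*` via `ℚ(i)`. -/
def Tplus : Set (ℤ × ℤ) :=
  {p | (p.1 % 24 = 2 ∧ p.2 % 12 = 1) ∨ (p.1 % 24 = 10 ∧ p.2 % 12 = 5)}

/-- The congruence conditions defining the negative part of `ρ*` via `ℚ(i)`. -/
def Tminus : Set (ℤ × ℤ) :=
  {p | (p.1 % 24 = 2 ∧ p.2 % 12 = 5) ∨ (p.1 % 24 = 10 ∧ p.2 % 12 = 1)}

namespace S15
open ModularForm
open Complex hiding eta

/-- `η(z) η(4z)`. -/
noncomputable def kk (z : ℂ) : ℂ := eta z * eta (4 * z)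

/-- `e^{2πi·5/24}`. -/
noncomputable def zt : ℂ := cexp (2 * Real.pi * I * (5 / 24))

lemma zt_ne : zt ≠ 0 := Complex.exp_ne_zero _

lemma zt_pow24 : zt ^ 24 = 1 := by
  rw [zt, ← Complex.exp_nat_mul, Complex.exp_eq_one_iff]
  exact ⟨5, by push_cast; ring⟩

lemma zt_pow12 : zt ^ 12 = -1 := by
  rw [zt, ← Complex.exp_nat_mul, ← Complex.exp_pi_mul_I, Complex.exp_eq_exp_iff_exists_int]
  exact ⟨2, by push_cast; ring⟩

lemma eta_add_one (z : ℂ) : eta (z + 1) = cexp (2 * Real.pi * I / 24) * eta z := by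
  have h : ∀ n, eta_q n (z + 1) = eta_q n z := by
    intro n
    rw [eta_q_eq_cexp, eta_q_eq_cexp, Complex.exp_eq_exp_iff_exists_int]
    exact ⟨n + 1, by push_cast; ring⟩
  unfold eta
  simp only [h]
  rw [← mul_assoc]
  congr 1
  simp only [Function.Periodic.qParam, ← Complex.exp_add]
  congr 1
  push_cast
  ring

lemma eta_add_nat (n : ℕ) (z : ℂ) : eta (z + n) = cexp (2 * Real.pi * I / 24) ^ n * eta z := by
  induction n with
  | zero => simp
  | succ n ih =>
    push_cast
    rw [← add_assoc, eta_add_one, ih]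
    ring

lemma kk_add_one (z : ℂ) : kk (z + 1) = zt * kk z := by
  unfold kk
  have := eta_add_nat 4 (4 * z)
  rw [eta_add_one, show 4 * (z + 1) = 4 * z + (4 : ℕ) by push_cast; ring, this]
  rw [zt, show (2 * Real.pi * I * (5 / 24) : ℂ) = (5 : ℕ) * (2 * Real.pi * I / 24) by
    push_cast; ring, Complex.exp_nat_mul]
  ring

lemma kk_sub_one (z : ℂ) : kk (z - 1) = zt⁻¹ * kk z := by
  have := kk_add_one (z - 1)
  rw [sub_add_cancel] at this
  rw [this, inv_mul_cancel_left₀ zt_ne]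

lemma kk_add_int (m : ℤ) (z : ℂ) : kk (z + m) = zt ^ m * kk z := by
  induction m using Int.induction_on with
  | zero => simp
  | succ n ih =>
    push_cast at *
    rw [← add_assoc, kk_add_one, ih, zpow_add_one₀ zt_ne]; ring
  | pred n ih =>
    push_cast at *
    rw [← add_sub_assoc, kk_sub_one, ih, zpow_sub_one₀ zt_ne]; ring

lemma kk_S {z : ℂ} (hz : 0 < z.im) : kk (-1 / (4 * z)) = -2 * I * z * kk z := by
  have hz0 : z ≠ 0 := by rintro rfl; simp at hz
  have h4 : 0 < (4 * z).im := by simpa using hz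
  have e1 : eta (-1 / z) = (sqrt I)⁻¹ * (sqrt z * eta z) := by
    simpa using eta_comp_eq_csqrt_I_inv (show z ∈ UpperHalfPlane.upperHalfPlaneSet from hz)
  have e2 : eta (-1 / (4 * z)) = (sqrt I)⁻¹ * (sqrt (4 * z) * eta (4 * z)) := by
    simpa using eta_comp_eq_csqrt_I_inv (show 4 * z ∈ UpperHalfPlane.upperHalfPlaneSet from h4)
  have sq : ∀ w : ℂ, w ≠ 0 → sqrt w * sqrt w = w := by
    intro w hw
    unfold sqrt
    rw [← Complex.cpow_add _ _ hw]; norm_num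
  have s4 : sqrt (4 * z) = 2 * sqrt z := by
    rw [sqrt_eq_exp hz0, sqrt_eq_exp (by simpa using hz0),
      show (4 * z : ℂ) = ((4 : ℝ) : ℂ) * z by push_cast; rfl,
      Complex.log_ofReal_mul (by norm_num) hz0, add_div, Complex.exp_add]
    congr 1
    rw [show (4 : ℝ) = 2 ^ 2 by norm_num, Real.log_pow]
    push_cast
    rw [mul_div_cancel_left₀ _ (by norm_num : (2 : ℂ) ≠ 0), ← Complex.ofReal_exp,
      Real.exp_log (by norm_num)]
    norm_num
  unfold kk
  rw [show 4 * (-1 / (4 * z)) = -1 / z by field_simp, e1, e2, s4]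
  have hI := sq I I_ne_zero
  have hz' := sq z hz0
  have hI2 : (sqrt I)⁻¹ * (sqrt I)⁻¹ = -I := by
    rw [← mul_inv, hI, inv_I]
  calc _ = 2 * ((sqrt I)⁻¹ * (sqrt I)⁻¹) * (sqrt z * sqrt z) * (eta z * eta (4*z)) := by ring
    _ = _ := by rw [hI2, hz']; ring

lemma kk_B {z : ℂ} (hz : 0 < z.im) : kk (z / (4 * z + 1)) = zt⁻¹ * (4 * z + 1) * kk z := by
  have hz0 : z ≠ 0 := by rintro rfl; simp at hz
  have h1 : 4 * z + 1 ≠ 0 := by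
    intro h
    have := congrArg Complex.im h
    simp at this; linarith
  set w : ℂ := -1 / (4 * z) with hw
  have hwi : 0 < w.im := by
    have : w = (4 * -z)⁻¹ := by rw [hw]; field_simp
    rw [this, Complex.inv_im]
    apply div_pos
    · simpa using hz
    · exact Complex.normSq_pos.mpr (by simpa using hz0)
  have hwi' : 0 < (w - 1).im := by simpa using hwi
  have hw0 : w - 1 ≠ 0 := by intro h; rw [h] at hwi'; simp at hwi'
  have e : z / (4 * z + 1) = -1 / (4 * (w - 1)) := by
    rw [div_eq_div_iff h1 (by simpa using hw0), hw]
    field_simp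
    ring
  rw [e, kk_S hwi', kk_sub_one, hw, kk_S hz]
  have e2 : (-1 / (4 * z) - 1) * (4 * z) = -(4 * z + 1) := by field_simp; ring
  linear_combination (zt⁻¹ * kk z * I * I) * e2 - (4 * z + 1) * kk z * zt⁻¹ * I_mul_I

/-- transformation statement for a matrix of `Γ₀(4)` -/
def MM (a b c d : ℤ) : Prop := ∃ n : ℤ,
  (8 : ℤ) ∣ n - (b * d - c * d + 2 * (d - 1)) ∧
  (3 : ℤ) ∣ n - ((a + d) * c - b * d * (c ^ 2 - 1)) ∧
  ∀ z : ℂ, 0 < z.im → kk ((a * z + b) / (4 * c * z + d)) = zt ^ n * (4 * c * z + d) * kk z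

lemma three_T : ∀ a b c d : ZMod 3, a * d - 4 * b * c = 1 →
    (a + (d + 4 * c)) * c - (b + a) * (d + 4 * c) * (c ^ 2 - 1) =
      (a + d) * c - b * d * (c ^ 2 - 1) + 1 := by decide

lemma three_B : ∀ a b c d : ZMod 3, a * d - 4 * b * c = 1 →
    ((a + 4 * b) + d) * (c + d) - b * d * ((c + d) ^ 2 - 1) =
      (a + d) * c - b * d * (c ^ 2 - 1) - 1 := by decide

lemma three_T' (a b c d : ℤ) (h : a * d - 4 * b * c = 1) :
    (3 : ℤ) ∣ (a + (d + 4 * c)) * c - (b + a) * (d + 4 * c) * (c ^ 2 - 1) -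
      ((a + d) * c - b * d * (c ^ 2 - 1) + 1) := by
  have h' : ((a * d - 4 * b * c : ℤ) : ZMod 3) = 1 := by rw [h]; simp
  push_cast at h'
  have := three_T a b c d h'
  refine (ZMod.intCast_zmod_eq_zero_iff_dvd _ 3).mp ?_
  push_cast
  rw [this, sub_self]

lemma three_B' (a b c d : ℤ) (h : a * d - 4 * b * c = 1) :
    (3 : ℤ) ∣ ((a + 4 * b) + d) * (c + d) - b * d * ((c + d) ^ 2 - 1) -
      ((a + d) * c - b * d * (c ^ 2 - 1) - 1) := by
  have h' : ((a * d - 4 * b * c : ℤ) : ZMod 3) = 1 := by rw [h]; simp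
  push_cast at h'
  have := three_B a b c d h'
  refine (ZMod.intCast_zmod_eq_zero_iff_dvd _ 3).mp ?_
  push_cast
  rw [this, sub_self]

lemma odd_ad {a b c d : ℤ} (h : a * d - 4 * b * c = 1) : Odd a ∧ Odd d := by
  have : Odd (a * d) := ⟨2 * (b * c), by linarith⟩
  exact Int.odd_mul.mp this

lemma eight_T (a b c d : ℤ) (h : a * d - 4 * b * c = 1) :
    (8 : ℤ) ∣ (b + a) * (d + 4 * c) - c * (d + 4 * c) + 2 * ((d + 4 * c) - 1) -
      (b * d - c * d + 2 * (d - 1) + 1) := by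
  obtain ⟨⟨s, hs⟩, -⟩ := odd_ad h
  obtain ⟨t, ht⟩ := Int.even_mul_succ_self (c - 1)
  have e : (b + a) * (d + 4 * c) - c * (d + 4 * c) + 2 * ((d + 4 * c) - 1) -
      (b * d - c * d + 2 * (d - 1) + 1) =
      8 * b * c + 8 * c + 4 * c * (2 * s) - 4 * ((c - 1) * (c - 1 + 1)) := by
    subst hs
    linear_combination h
  rw [e, ht]
  exact ⟨b * c + c + c * s - t, by ring⟩

lemma eight_B (b c d : ℤ) (h : Odd d) :
    (8 : ℤ) ∣ b * d - (c + d) * d + 2 * (d - 1) -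
      (b * d - c * d + 2 * (d - 1) - 1) := by
  have := Int.eight_dvd_sq_sub_one_of_odd h
  obtain ⟨t, ht⟩ := this
  exact ⟨-t, by linear_combination -ht⟩

lemma den_ne {c d : ℤ} (h : c ≠ 0 ∨ d ≠ 0) {z : ℂ} (hz : 0 < z.im) : (4 * c * z + d : ℂ) ≠ 0 := by
  intro h0
  have h1 := congrArg Complex.im h0
  simp at h1
  rcases h1 with h1 | h1
  · subst h1
    simp at h0
    omega
  · exact hz.ne' h1

lemma ne_of {a b c d : ℤ} (h : a * d - 4 * b * c = 1) : c ≠ 0 ∨ d ≠ 0 := by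
  by_contra! h'
  simp [h'.1, h'.2] at h

lemma MM_T {a b c d : ℤ} (h : a * d - 4 * b * c = 1) :
    MM a (b + a) c (d + 4 * c) ↔ MM a b c d := by
  have h8 := eight_T a b c d h
  have h3 := three_T' a b c d h
  constructor
  · rintro ⟨n, n8, n3, hn⟩
    refine ⟨n - 1, ?_, ?_, ?_⟩
    · have := dvd_add n8 h8; ring_nf at this ⊢; exact this
    · have := dvd_add n3 h3; ring_nf at this ⊢; exact this
    · intro z hz
      have := hn (z - 1) (by simpa using hz)
      rw [kk_sub_one] at this
      push_cast at this
      rw [show (a * (z - 1) + (b + a) : ℂ) = a * z + b by ring,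
        show (4 * c * (z - 1) + (d + 4 * c) : ℂ) = 4 * c * z + d by ring] at this
      rw [this, zpow_sub_one₀ zt_ne]
      ring
  · rintro ⟨n, n8, n3, hn⟩
    refine ⟨n + 1, ?_, ?_, ?_⟩
    · have := dvd_sub n8 h8; ring_nf at this ⊢; exact this
    · have := dvd_sub n3 h3; ring_nf at this ⊢; exact this
    · intro z hz
      have := hn (z + 1) (by simpa using hz)
      rw [kk_add_one] at this
      push_cast
      rw [show (a * (z + 1) + b : ℂ) = a * z + (b + a) by ring,
        show (4 * c * (z + 1) + d : ℂ) = 4 * c * z + (d + 4 * c) by ring] at this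
      rw [this, zpow_add_one₀ zt_ne]
      ring

lemma im_B {z : ℂ} (hz : 0 < z.im) (e : ℝ) : 0 < (z / (4 * e * z + 1)).im := by
  have hz0 : z ≠ 0 := by rintro rfl; simp at hz
  have : z / (4 * e * z + 1) = (4 * e + z⁻¹)⁻¹ := by
    rw [show (4 * e + z⁻¹ : ℂ) = (4 * e * z + 1) / z by field_simp, inv_div]
  have hi : (z⁻¹).im < 0 := by
    rw [Complex.inv_im]
    exact div_neg_of_neg_of_pos (by linarith) (Complex.normSq_pos.mpr hz0)
  have hi2 : (4 * e + z⁻¹ : ℂ).im < 0 := by simpa using hi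
  rw [this, Complex.inv_im]
  apply div_pos (by linarith)
  apply Complex.normSq_pos.mpr
  intro h; rw [h] at hi2; simp at hi2

lemma MM_B {a b c d : ℤ} (h : a * d - 4 * b * c = 1) :
    MM (a + 4 * b) b (c + d) d ↔ MM a b c d := by
  have h8 := eight_B b c d (odd_ad h).2
  have h3 := three_B' a b c d h
  have hne := ne_of h
  have h' : (a + 4 * b) * d - 4 * b * (c + d) = 1 := by linarith
  have hne' := ne_of h'
  constructor
  · rintro ⟨n, n8, n3, hn⟩
    refine ⟨n + 1, ?_, ?_, ?_⟩
    · have := dvd_add n8 h8; ring_nf at this ⊢; exact this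
    · have := dvd_add n3 h3; ring_nf at this ⊢; exact this
    · intro z hz
      have hw : 0 < (z / (1 - 4 * z)).im := by
        have := im_B hz (-1)
        convert this using 3
        push_cast; ring
      set w := z / (1 - 4 * z) with hwdef
      have hz1 : (1 - 4 * z : ℂ) ≠ 0 := by
        intro h0; rw [h0] at hwdef; rw [hwdef] at hw; simp at hw
      have hw1 : 4 * w + 1 = 1 / (1 - 4 * z) := by rw [hwdef]; field_simp; ring
      have hzw : z = w / (4 * w + 1) := by rw [hw1, hwdef, div_div_div_cancel_right₀ hz1, div_one]
      have := hn w hw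
      have hB := kk_B hw
      rw [← hzw] at hB
      have hd := den_ne hne hz
      have e : (((a + 4 * b : ℤ) : ℂ) * w + b) / (4 * ((c + d : ℤ) : ℂ) * w + d) =
          (a * z + b) / (4 * c * z + d) := by
        have hd' := den_ne hne' hw
        rw [div_eq_div_iff hd' hd, hwdef]
        push_cast
        field_simp
        ring
      rw [e] at this
      rw [this, hB, hw1, zpow_add_one₀ zt_ne, hwdef]
      have := zt_ne
      push_cast
      field_simp
      ring
  · rintro ⟨n, n8, n3, hn⟩
    refine ⟨n - 1, ?_, ?_, ?_⟩
    · have := dvd_sub n8 h8; ring_nf at this ⊢; exact this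
    · have := dvd_sub n3 h3; ring_nf at this ⊢; exact this
    · intro z hz
      have hw : 0 < (z / (4 * z + 1)).im := by
        have := im_B hz 1
        convert this using 3
        push_cast; ring
      have hB := kk_B hz
      set w := z / (4 * z + 1) with hwdef
      have hz1 : (4 * z + 1 : ℂ) ≠ 0 := by
        intro h0; rw [h0] at hwdef; rw [hwdef] at hw; simp at hw
      have := hn w hw
      have hd := den_ne hne hw
      have hd' := den_ne hne' hz
      have e : (((a + 4 * b : ℤ) : ℂ) * z + b) / (4 * ((c + d : ℤ) : ℂ) * z + d) =
          (a * w + b) / (4 * c * w + d) := by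
        rw [div_eq_div_iff hd' hd, hwdef]
        push_cast
        field_simp
        ring
      rw [e, this, hB, zpow_sub_one₀ zt_ne, hwdef]
      push_cast
      field_simp
      ring

lemma MM_base {a b d : ℤ} (h : a * d = 1) : MM a b 0 d := by
  rcases Int.eq_one_or_neg_one_of_mul_eq_one h with rfl | rfl
  · obtain rfl : d = 1 := by linarith
    refine ⟨b, ⟨0, by ring⟩, ⟨0, by ring⟩, ?_⟩
    intro z hz
    simpa using kk_add_int b z
  · obtain rfl : d = -1 := by linarith
    refine ⟨12 - b, ⟨2, by ring⟩, ⟨4 - 0, by ring⟩, ?_⟩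
    intro z hz
    have := kk_add_int (-b) z
    have e : (((-1 : ℤ) : ℂ) * z + b) / (4 * ((0 : ℤ) : ℂ) * z + ((-1 : ℤ) : ℂ)) = z + ((-b : ℤ) : ℂ) := by
      push_cast; ring
    rw [e, this, sub_eq_add_neg, zpow_add₀ zt_ne, show zt ^ (12 : ℤ) = -1 from mod_cast zt_pow12]
    push_cast; ring

lemma MM_all (N : ℕ) : ∀ a b c d : ℤ, c.natAbs + d.natAbs ≤ N → a * d - 4 * b * c = 1 → MM a b c d := by
  induction N with
  | zero =>
    intro a b c d hN h
    obtain ⟨rfl, rfl⟩ : c = 0 ∧ d = 0 := by omega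
    simp at h
  | succ N ih =>
    intro a b c d hN h
    by_cases hc : c = 0
    · subst hc; exact MM_base (by linarith)
    have hd : Odd d := (odd_ad h).2
    obtain ⟨s, hs⟩ := hd
    rcases lt_or_gt_of_ne (show d.natAbs ≠ 2 * c.natAbs by omega) with hlt | hlt
    · by_cases hsg : (c + d).natAbs < c.natAbs
      · exact (MM_B h).mp (ih _ _ _ _ (by omega) (by linarith))
      · have h2 : (a - 4 * b) * d - 4 * b * (c - d) = 1 := by linarith
        have := (MM_B h2).mpr (ih _ _ _ _ (by omega) h2)
        simpa using this
    · by_cases hsg : (d + 4 * c).natAbs < d.natAbs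
      · exact (MM_T h).mp (ih _ _ _ _ (by omega) (by linarith))
      · have h2 : a * (d - 4 * c) - 4 * (b - a) * c = 1 := by linarith
        have := (MM_T h2).mpr (ih _ _ _ _ (by omega) h2)
        simpa using this

lemma kk_level {A B C D : ℤ} (h : A * D - B * (2304 * C) = 1) (hD : (2304 : ℤ) ∣ D - 1)
    {z : ℂ} (hz : 0 < z.im) :
    kk (24 * ((A * z + B) / (2304 * C * z + D))) = (2304 * C * z + D) * kk (24 * z) := by
  obtain ⟨n, n8, n3, hn⟩ := MM_all _ A (24 * B) (24 * C) D le_rfl (by linarith)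
  obtain ⟨m, hm⟩ : (24 : ℤ) ∣ n := by
    obtain ⟨s, hs⟩ := n8
    obtain ⟨t, ht⟩ := n3
    obtain ⟨u, hu⟩ := hD
    have h8 : (8 : ℤ) ∣ n := ⟨s + (3 * B * D - 3 * C * D + 2 * 288 * u), by
      linear_combination hs + 2 * hu⟩
    have h3 : (3 : ℤ) ∣ n := ⟨t + ((A + D) * (8 * C) - 8 * B * D * ((24 * C) ^ 2 - 1)), by
      linear_combination ht⟩
    omega
  have := hn (24 * z) (by simpa using hz)
  rw [hm, zpow_mul, show zt ^ (24 : ℤ) = 1 from mod_cast zt_pow24, one_zpow, one_mul] at this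
  push_cast at this
  rw [show (4 * (24 * C) * (24 * z) + D : ℂ) = 2304 * C * z + D by ring] at this
  rw [← this]
  congr 1
  ring
lemma prod_bound {x : ℂ} (hx : ‖x‖ < 1) (k n : ℕ) :
    ‖∏ i ∈ Finset.range (n + 1), (1 - x ^ (k + i + 1))‖ ≤ Real.exp ((1 - ‖x‖)⁻¹) := by
  have h0 := norm_nonneg x
  rw [norm_prod]
  calc ∏ i ∈ Finset.range (n + 1), ‖1 - x ^ (k + i + 1)‖
      ≤ ∏ i ∈ Finset.range (n + 1), Real.exp (‖x‖ ^ i) := by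
        refine Finset.prod_le_prod (fun _ _ => norm_nonneg _) fun i _ => ?_
        calc ‖1 - x ^ (k + i + 1)‖ ≤ ‖(1:ℂ)‖ + ‖x ^ (k + i + 1)‖ := norm_sub_le _ _
          _ = ‖x‖ ^ (k + i + 1) + 1 := by rw [norm_pow]; simp [add_comm]
          _ ≤ ‖x‖ ^ i + 1 := by
            have := pow_le_pow_of_le_one h0 hx.le (show i ≤ k + i + 1 by omega)
            linarith
          _ ≤ _ := Real.add_one_le_exp _
    _ = Real.exp (∑ i ∈ Finset.range (n + 1), ‖x‖ ^ i) := (Real.exp_sum _ _).symm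
    _ ≤ _ := by
      rw [Real.exp_le_exp, ← tsum_geometric_of_lt_one h0 hx]
      exact (summable_geometric_of_lt_one h0 hx).sum_le_tsum _ (fun _ _ => pow_nonneg h0 _)

lemma term_bound {x : ℂ} (hx : ‖x‖ < 1) (k n : ℕ) :
    ‖x ^ ((k + 1) * n) * ∏ i ∈ Finset.range (n + 1), (1 - x ^ (k + i + 1))‖
      ≤ ‖x‖ ^ n * Real.exp ((1 - ‖x‖)⁻¹) := by
  rw [norm_mul, norm_pow]
  exact mul_le_mul (pow_le_pow_of_le_one (norm_nonneg x) hx.le (by nlinarith))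
    (prod_bound hx k n) (norm_nonneg _) (by positivity)

lemma summ_bd {x : ℂ} (hx : ‖x‖ < 1) :
    Summable fun n : ℕ => ‖x‖ ^ n * Real.exp ((1 - ‖x‖)⁻¹) :=
  (summable_geometric_of_lt_one (norm_nonneg x) hx).mul_right _

lemma summ_pent {x : ℂ} (hx : ‖x‖ < 1) :
    Summable fun k : ℤ => (-1 : ℂ) ^ k * x ^ pentagonal k := by
  refine Summable.of_norm ?_
  have : (fun k : ℤ => ‖(-1 : ℂ) ^ k * x ^ pentagonal k‖) = (fun n : ℕ => ‖x‖ ^ n) ∘ pentagonal := by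
    ext k; simp
  rw [this]
  exact (summable_geometric_of_lt_one (norm_nonneg x) hx).comp_injective pentagonal_injective

lemma pent_hasSum {x : ℂ} (hx : ‖x‖ < 1) :
    HasSum (fun k : ℕ => (-1) ^ k * (x ^ pentagonal (-k) - x ^ pentagonal (k + 1)))
      (∑' k : ℤ, (-1 : ℂ) ^ k * x ^ pentagonal k) := by
  have hs := summ_pent hx
  have h := hs.hasSum
  rw [← (Equiv.neg ℤ).hasSum_iff] at h
  have h2 := h.nat_add_neg_add_one
  convert h2 using 2 with k
  have e1 : ((-1 : ℂ) ^ (k + 1 : ℤ)) = -(-1) ^ k := by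
    rw [zpow_add₀ (by norm_num)]; simp
  simp only [Function.comp_apply, Equiv.neg_apply, neg_neg, e1, zpow_neg, zpow_natCast]
  rcases neg_one_pow_eq_or ℂ k with h | h <;> rw [h] <;> ring

lemma euler {x : ℂ} (hx : ‖x‖ < 1) :
    ∏' n : ℕ, (1 - x ^ (n + 1)) = ∑' k : ℤ, (-1 : ℂ) ^ k * x ^ pentagonal k := by
  rw [← (pent_hasSum hx).tsum_eq]
  have hsum : ∀ k : ℕ, Summable fun n : ℕ =>
      x ^ ((k + 1) * n) * ∏ i ∈ Finset.range (n + 1), (1 - x ^ (k + i + 1)) := fun k =>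
    Summable.of_norm_bounded (summ_bd hx) (term_bound hx k)
  refine Pentagonal.tprod_one_sub_pow ?_ hsum ?_ (pent_hasSum hx).summable ?_
  · exact tendsto_pow_atTop_nhds_zero_of_norm_lt_one hx
  · intro k
    have := multipliable_one_add_of_summable (f := fun n : ℕ => -x ^ (n + k + 1)) (by
      simpa [add_assoc] using
        (summable_nat_add_iff (k + 1)).mpr (summable_geometric_of_lt_one (norm_nonneg _) hx))
    simpa [sub_eq_add_neg] using this
  · refine squeeze_zero_norm (a := fun k : ℕ => ‖x‖ ^ k * ∑' n : ℕ, ‖x‖ ^ n * Real.exp ((1 - ‖x‖)⁻¹)) ?_ ?_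
    · intro k
      rw [norm_mul, norm_mul, norm_pow, norm_pow, norm_neg, norm_one, one_pow, one_mul]
      refine mul_le_mul (pow_le_pow_of_le_one (norm_nonneg x) hx.le ?_)
        (tsum_of_norm_bounded (summ_bd hx).hasSum (term_bound hx k)) (norm_nonneg _) (by positivity)
      rw [Nat.le_div_iff_mul_le (by norm_num)]; nlinarith
    · simpa using (tendsto_pow_atTop_nhds_zero_of_lt_one (norm_nonneg x) hx).mul_const
        (∑' n : ℕ, ‖x‖ ^ n * Real.exp ((1 - ‖x‖)⁻¹))

/-- the coefficient of the eta series -/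
noncomputable def vv (y : ℤ) : ℂ := if y % 12 = 1 then 1 else if y % 12 = 5 then -1 else 0

/-- the terms -/
noncomputable def ee (y : ℤ) (z : ℂ) : ℂ := cexp (2 * Real.pi * I * (y : ℂ) ^ 2 * z)

lemma summ_ee {z : ℂ} (hz : 0 < z.im) : Summable fun y : ℤ => ee y z := by
  have h := (summable_jacobiTheta₂_term_iff 0 (2 * z)).2 (by simpa using hz)
  refine h.congr fun y => ?_
  simp only [jacobiTheta₂_term, ee]
  congr 1; ring

lemma norm_vv (y : ℤ) : ‖vv y‖ ≤ 1 := by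
  unfold vv; split_ifs <;> simp

lemma summ_vv {z : ℂ} (hz : 0 < z.im) : Summable fun y : ℤ => ‖vv y * ee y z‖ := by
  refine Summable.of_nonneg_of_le (fun _ => norm_nonneg _) (fun y => ?_) (summ_ee hz).norm
  rw [norm_mul]
  exact mul_le_of_le_one_left (norm_nonneg _) (norm_vv y)

/-- reindexing map -/
def rr (k : ℤ) : ℤ := if k % 2 = 0 then 1 - 6 * k else 6 * k - 1

lemma rr_inj : Function.Injective rr := by
  intro a b h
  unfold rr at h
  split_ifs at h <;> omega

lemma rr_sq (k : ℤ) : (rr k) ^ 2 = 1 + 24 * (pentagonal k : ℤ) := by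
  have := two_mul_natCast_pentagonal k
  unfold rr; split_ifs <;> linear_combination (-12) * this

lemma vv_rr (k : ℤ) : vv (rr k) = (-1) ^ k := by
  rcases Int.even_or_odd k with h | h
  · rw [h.neg_one_zpow]
    obtain ⟨m, rfl⟩ := h
    have h1 : rr (m + m) = 1 - 6 * (m + m) := if_pos (by omega)
    rw [h1, vv, if_pos (by omega)]
  · rw [h.neg_one_zpow]
    obtain ⟨m, rfl⟩ := h
    have h1 : rr (2 * m + 1) = 6 * (2 * m + 1) - 1 := if_neg (by omega)
    rw [h1, vv, if_neg (by omega), if_pos (by omega)]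

lemma supp_vv (z : ℂ) : Function.support (fun y : ℤ => vv y * ee y z) ⊆ Set.range rr := by
  intro y hy
  have hv : vv y ≠ 0 := left_ne_zero_of_mul hy
  unfold vv at hv
  by_cases h1 : y % 12 = 1
  · refine ⟨(1 - y) / 6, ?_⟩
    unfold rr; split_ifs <;> omega
  · by_cases h5 : y % 12 = 5
    · refine ⟨(y + 1) / 6, ?_⟩
      unfold rr; split_ifs <;> omega
    · simp [h1, h5] at hv

lemma eta_series {z : ℂ} (hz : 0 < z.im) : ∑' y : ℤ, vv y * ee y z = eta (24 * z) := by
  rw [← rr_inj.tsum_eq (supp_vv z)]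
  have hx : ‖cexp (2 * Real.pi * I * (24 * z))‖ < 1 := by
    rw [Complex.norm_exp]
    simp
    positivity
  have : eta (24 * z) = cexp (2 * Real.pi * I * z) *
      ∏' n : ℕ, (1 - cexp (2 * Real.pi * I * (24 * z)) ^ (n + 1)) := by
    unfold eta
    congr 1
    · simp only [Function.Periodic.qParam]
      congr 1; push_cast; ring
    · simp only [eta_q_eq_pow]
  rw [this, euler hx, ← tsum_mul_left]
  refine tsum_congr fun k => ?_
  rw [vv_rr, mul_left_comm]
  congr 1
  rw [← Complex.exp_nat_mul, ← Complex.exp_add, ee]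
  congr 1
  have := congrArg (Int.cast : ℤ → ℂ) (rr_sq k)
  push_cast at this
  rw [mul_assoc, this]; ring

/-- coefficients for the x variable -/
noncomputable def uu (x : ℤ) : ℂ := if x % 24 = 2 then 1 else if x % 24 = 10 then -1 else 0

lemma uu_two (x : ℤ) : uu (2 * x) = vv x := by
  unfold uu vv
  split_ifs <;> first | rfl | omega

lemma ee_two (x : ℤ) (z : ℂ) : ee (2 * x) z = ee x (4 * z) := by
  unfold ee; push_cast; congr 1; ring

lemma norm_uu (y : ℤ) : ‖uu y‖ ≤ 1 := by
  unfold uu; split_ifs <;> simp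

lemma summ_uu {z : ℂ} (hz : 0 < z.im) : Summable fun y : ℤ => ‖uu y * ee y z‖ := by
  refine Summable.of_nonneg_of_le (fun _ => norm_nonneg _) (fun y => ?_) (summ_ee hz).norm
  rw [norm_mul]
  exact mul_le_of_le_one_left (norm_nonneg _) (norm_uu y)

lemma eta_series2 {z : ℂ} (hz : 0 < z.im) : ∑' y : ℤ, uu y * ee y z = eta (96 * z) := by
  have hi : Function.Injective (fun x : ℤ => 2 * x) := fun a b h => by
    simp only at h; omega
  have hs : Function.support (fun y : ℤ => uu y * ee y z) ⊆ Set.range (fun x : ℤ => 2 * x) := by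
    intro y hy
    have hv : uu y ≠ 0 := left_ne_zero_of_mul hy
    unfold uu at hv
    refine ⟨y / 2, ?_⟩
    by_cases h1 : y % 24 = 2
    · simp only; omega
    · by_cases h5 : y % 24 = 10
      · simp only; omega
      · simp [h1, h5] at hv
  rw [← hi.tsum_eq hs]
  simp only [uu_two, ee_two]
  rw [eta_series (by simpa using hz)]
  congr 1; ring

/-- the terms in two variables -/
noncomputable def ff (z : ℂ) (p : ℤ × ℤ) : ℂ :=
  cexp (2 * Real.pi * I * ((p.1 : ℂ) ^ 2 + (p.2 : ℂ) ^ 2) * z)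

lemma ff_eq (z : ℂ) (p : ℤ × ℤ) : ff z p = ee p.1 z * ee p.2 z := by
  unfold ff ee; rw [← Complex.exp_add]; congr 1; ring

lemma summ_ff {z : ℂ} (hz : 0 < z.im) : Summable (ff z) := by
  have := summable_mul_of_summable_norm (summ_ee hz).norm (summ_ee hz).norm
  exact this.congr fun p => (ff_eq z p).symm

lemma theta_eq {z : ℂ} (hz : 0 < z.im) :
    (∑' p : Tplus, ff z p) - ∑' p : Tminus, ff z p = eta (24 * z) * eta (4 * (24 * z)) := by
  rw [tsum_subtype Tplus (ff z), tsum_subtype Tminus (ff z),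
    ← ((summ_ff hz).indicator _).tsum_sub ((summ_ff hz).indicator _),
    show 4 * (24 * z) = 96 * z by ring, ← eta_series2 hz, ← eta_series hz, mul_comm,
    tsum_mul_tsum_of_summable_norm (summ_uu hz) (summ_vv hz)]
  refine tsum_congr fun ⟨x, y⟩ => ?_
  have key : (Tplus.indicator (1 : ℤ × ℤ → ℂ) (x, y)) - Tminus.indicator (1 : ℤ × ℤ → ℂ) (x, y)
      = uu x * vv y := by
    classical
    simp only [Set.indicator_apply, Tplus, Tminus, Set.mem_ofPred_eq, uu, vv, Pi.one_apply]
    by_cases h1 : x % 24 = 2 <;> by_cases h2 : x % 24 = 10 <;> by_cases h3 : y % 12 = 1 <;>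
      by_cases h4 : y % 12 = 5 <;> simp [h1, h2, h3, h4]
  have i1 : ∀ S : Set (ℤ × ℤ), S.indicator (ff z) (x, y) = S.indicator 1 (x, y) * ff z (x, y) := by
    intro S
    by_cases h : (x, y) ∈ S <;> simp [h]
  rw [i1, i1, ← sub_mul, key, ff_eq]
  ring

open UpperHalfPlane in
/-- diagonal matrix -/
noncomputable def dg (N : ℕ) (hN : (N : ℝ) ≠ 0) : GL (Fin 2) ℝ :=
  Matrix.GeneralLinearGroup.mkOfDetNeZero !![(N : ℝ), 0; 0, 1] (by simpa using hN)

lemma dg_cusp (N : ℕ) (hN : (N : ℝ) ≠ 0) {c : OnePoint ℝ}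
    (hc : IsCusp c (Matrix.SpecialLinearGroup.mapGL (R := ℤ) ℝ).range) :
    IsCusp (dg N hN • c) (Matrix.SpecialLinearGroup.mapGL (R := ℤ) ℝ).range := by
  rw [isCusp_SL2Z_iff] at hc ⊢
  obtain ⟨d, rfl⟩ := hc
  induction d using OnePoint.rec with
  | infty =>
    refine ⟨OnePoint.infty, ?_⟩
    rw [OnePoint.map_infty, OnePoint.smul_infty_eq_ite]
    simp [dg, Matrix.GeneralLinearGroup.mkOfDetNeZero]
  | coe q =>
    refine ⟨((N * q : ℚ) : OnePoint ℚ), ?_⟩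
    rw [OnePoint.map_some, OnePoint.map_some, OnePoint.smul_some_eq_ite]
    simp [dg, Matrix.GeneralLinearGroup.mkOfDetNeZero]

lemma dg_bdd (N : ℕ) (hN : (N : ℝ) ≠ 0) (γ : Matrix.SpecialLinearGroup (Fin 2) ℤ) :
    UpperHalfPlane.IsBoundedAtImInfty ((discriminant ∣[(12 : ℤ)] dg N hN) ∣[(12 : ℤ)] γ) := by
  have hc : IsCusp (Matrix.SpecialLinearGroup.mapGL ℝ γ • OnePoint.infty)
      (Matrix.SpecialLinearGroup.mapGL (R := ℤ) ℝ).range := isCusp_SL2Z_iff'.2 ⟨γ, rfl⟩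
  have h := ModularFormClass.bdd_at_cusps CuspForm.discriminant (dg_cusp N hN hc)
  rw [OnePoint.IsBoundedAt.smul_iff, OnePoint.isBoundedAt_iff_forall_SL2Z hc] at h
  exact h γ rfl

lemma dg_apply (N : ℕ) (hN : (N : ℝ) ≠ 0) (τ : UpperHalfPlane) :
    (discriminant ∣[(12 : ℤ)] dg N hN) τ = (N : ℂ) ^ 11 * eta (N * τ) ^ 24 := by
  have hp : (0 : ℝ) < N := lt_of_le_of_ne (Nat.cast_nonneg N) hN.symm
  have hd : (Matrix.GeneralLinearGroup.det (dg N hN)).val = (N : ℝ) := by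
    simp [dg, Matrix.GeneralLinearGroup.mkOfDetNeZero]
  have hs : ((dg N hN • τ : UpperHalfPlane) : ℂ) = N * τ := by
    rw [UpperHalfPlane.coe_smul_of_det_pos (by rw [hd]; exact hp)]
    simp [UpperHalfPlane.num, UpperHalfPlane.denom, dg, Matrix.GeneralLinearGroup.mkOfDetNeZero]
  have hden : UpperHalfPlane.denom (dg N hN) τ = 1 := by
    simp [UpperHalfPlane.denom, dg, Matrix.GeneralLinearGroup.mkOfDetNeZero]
  have hσ : UpperHalfPlane.σ (dg N hN) = ContinuousAlgEquiv.refl ℝ ℂ := by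
    unfold UpperHalfPlane.σ
    rw [if_pos (by rw [hd]; exact hp)]
  rw [ModularForm.slash_apply, hσ, hden, hd, discriminant, hs, abs_of_pos hp]
  simp
  rw [mul_comm]

/-- the modular form as a function -/
noncomputable def hh (τ : UpperHalfPlane) : ℂ := 2 * kk (24 * τ)

lemma hh_bdd (γ : Matrix.SpecialLinearGroup (Fin 2) ℤ) :
    UpperHalfPlane.IsBoundedAtImInfty (hh ∣[(1 : ℤ)] γ) := by
  have h1 := dg_bdd 24 (by norm_num) γ
  have h2 := dg_bdd 96 (by norm_num) γ
  have h3 := (h1.mul h2).const_mul_left ((2 : ℂ) ^ 24 / (24 ^ 11 * 96 ^ 11))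
  refine Asymptotics.IsBigO.of_pow (n := 24) (by norm_num) ?_
  rw [one_pow]
  refine h3.congr_left ?_
  · intro τ
    symm
    simp only [Pi.pow_apply, Pi.mul_apply, ModularForm.SL_slash_apply, dg_apply, hh, kk]
    set d := UpperHalfPlane.denom _ (τ : ℂ)
    have e : (4 : ℂ) * (24 * ((γ • τ : UpperHalfPlane) : ℂ)) = 96 * (γ • τ : UpperHalfPlane) := by
      ring
    rw [e]
    have e2 : (d ^ (-1 : ℤ)) ^ 24 = d ^ (-12 : ℤ) * d ^ (-12 : ℤ) := by
      rw [← zpow_natCast, ← zpow_mul]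
      rcases eq_or_ne d 0 with h | h
      · simp [h]
      · rw [← zpow_add₀ h]; norm_num
    rw [mul_pow, e2]
    push_cast
    ring

lemma hh_slash (γ : Matrix.SpecialLinearGroup (Fin 2) ℤ)
    (hγ : γ ∈ CongruenceSubgroup.Gamma1 2304) : hh ∣[(1 : ℤ)] γ = hh := by
  rw [CongruenceSubgroup.Gamma1_mem] at hγ
  obtain ⟨-, h2, h3⟩ := hγ
  rw [ZMod.intCast_zmod_eq_zero_iff_dvd] at h3
  have hD : (2304 : ℤ) ∣ γ 1 1 - 1 := by
    rw [← Nat.cast_ofNat, ← ZMod.intCast_zmod_eq_zero_iff_dvd]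
    push_cast; rw [h2]; simp
  obtain ⟨C, hC⟩ := h3
  push_cast at hC
  have hdet := γ.det_coe
  rw [Matrix.det_fin_two, hC] at hdet
  ext τ
  have hk := kk_level hdet hD τ.im_pos
  have hC' : ((γ 1 0 : ℤ) : ℂ) = 2304 * C := by rw [hC]; push_cast; ring
  have hden : UpperHalfPlane.denom (Matrix.SpecialLinearGroup.toGL
      ((Matrix.SpecialLinearGroup.map (Int.castRingHom ℝ)) γ)) (τ : ℂ) =
      2304 * C * τ + (γ 1 1 : ℤ) := by
    rw [← hC']
    simp [UpperHalfPlane.denom]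
  have hne := UpperHalfPlane.denom_ne_zero (Matrix.SpecialLinearGroup.toGL
      ((Matrix.SpecialLinearGroup.map (Int.castRingHom ℝ)) γ)) τ
  rw [hden] at hne
  rw [ModularForm.SL_slash_apply, hden, hh, hh, UpperHalfPlane.coe_specialLinearGroup_apply]
  simp only [eq_intCast, Complex.ofReal_intCast, hC']
  rw [UpperHalfPlane.coe] at *
  rw [hk, zpow_neg_one]
  field_simp

open UpperHalfPlane in
/-- the modular form -/
noncomputable def GG : ModularForm (CongruenceSubgroup.Gamma1 2304) 1 where
  toFun := hh
  slash_action_eq' A hA := by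
    obtain ⟨A, hA, rfl⟩ := hA
    exact hh_slash A hA
  holo' := by
    rw [UpperHalfPlane.mdifferentiable_iff]
    have hd : ∀ c : ℝ, 0 < c → ∀ z ∈ upperHalfPlaneSet,
        DifferentiableAt ℂ (fun z : ℂ => eta ((c : ℂ) * z)) z := by
      intro c hc z hz
      have hz' : (0 : ℝ) < z.im := hz
      have : DifferentiableAt ℂ eta ((c : ℂ) * z) := by
        refine differentiableAt_eta_of_mem_upperHalfPlaneSet ?_
        show 0 < ((c : ℂ) * z).im
        simpa using mul_pos hc hz'
      exact this.comp z (by fun_prop)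
    refine DifferentiableOn.congr (f := fun z : ℂ => 2 * (eta (((24 : ℝ) : ℂ) * z) * eta (((96 : ℝ) : ℂ) * z)))
      (fun z hz => (((hd 24 (by norm_num) z hz).mul
        (hd 96 (by norm_num) z hz)).const_mul 2).differentiableWithinAt) fun z hz => ?_
    have e : (4 : ℂ) * (24 * z) = 96 * z := by ring
    simp [hh, kk, ofComplex_apply_of_im_pos hz, e]
  bdd_at_cusps' hc := by
    rw [Subgroup.IsArithmetic.isCusp_iff_isCusp_SL2Z] at hc
    rw [OnePoint.isBoundedAt_iff_forall_SL2Z hc]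
    intro γ _
    exact hh_bdd γ

lemma GG_apply (τ : UpperHalfPlane) : GG τ = 2 * kk (24 * τ) := rfl

end S15

/-- The series `q⁵ρ*(q²⁴) = 2 Σ_{(x,y)∈T₊} q^{x²+y²} - 2 Σ_{(x,y)∈T₋} q^{x²+y²}`
(with `q = e^{2πiτ}`) is a modular form of weight `1` for `Γ₁(2304)`. -/
theorem stmt_15 :
    ∃ g : ModularForm (CongruenceSubgroup.Gamma1 2304) 1,
      ∀ τ : UpperHalfPlane,
        g τ =
          2 * (∑' p : Tplus,
            Complex.exp (2 * Real.pi * Complex.I *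
              (((p : ℤ × ℤ).1 : ℂ) ^ 2 + ((p : ℤ × ℤ).2 : ℂ) ^ 2) * (τ : ℂ))) -
          2 * (∑' p : Tminus,
            Complex.exp (2 * Real.pi * Complex.I *
              (((p : ℤ × ℤ).1 : ℂ) ^ 2 + ((p : ℤ × ℤ).2 : ℂ) ^ 2) * (τ : ℂ))) := by
  refine ⟨S15.GG, fun τ => ?_⟩
  have h := S15.theta_eq τ.im_pos
  simp only [S15.ff] at h
  rw [S15.GG_apply, S15.kk, ← mul_sub]
  exact congrArg (fun w => 2 * w) h.symm
end

section
/- Define w : ℤ × ℤ → ℤ by: w(x,y) = 1 if x ≡ 0 (mod 24) and y ≡ 1 (mod 6); w(x,y) = 2 if x ≡ 4 (mod 24) and y ≡ 3 (mod 12); w(x,y) = -1 if x ≡ 12 (mod 24) and y ≡ 1 (mod 6); w(x,y) = -2 if x ≡ 8 (mod 24) and y ≡ 3 (mod 12); w(x,y) = 2 if (x ≡ 2 (mod 24) and y ≡ 1 (mod 12)) or (x ≡ 10 (mod 24) and y ≡ 5 (mod 12)); w(x,y) = -2 if (x ≡ 2 (mod 24) and y ≡ 5 (mod 12)) or (x ≡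 10 (mod 24) and y ≡ 1 (mod 12)); and w(x,y) = 0 otherwise. Then there exists a modular form F of weight 1 for Γ₁(2304) such that for every τ in the complex upper half-plane, F(τ) = Σ_{(x,y)∈ℤ²} w(x,y) e^{2πi(x²+y²)τ}. (This F is the threefield theta series Θ = qρ(q^{24}) + q⁵ρ*(q^{24}) written via the field ℚ(i).) -/
/-- The weight function `w : ℤ × ℤ → ℤ` encoding the congruence conditions
(from the field `ℚ(i)`) defining the threefield theta series
`Θ = qρ(q²⁴) + q⁵ρ*(q²⁴)`. -/
def w (p : ℤ × ℤ) : ℤ :=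
  if p.1 % 24 = 0 ∧ p.2 % 6 = 1 then 1
  else if p.1 % 24 = 4 ∧ p.2 % 12 = 3 then 2
  else if p.1 % 24 = 12 ∧ p.2 % 6 = 1 then -1
  else if p.1 % 24 = 8 ∧ p.2 % 12 = 3 then -2
  else if (p.1 % 24 = 2 ∧ p.2 % 12 = 1) ∨ (p.1 % 24 = 10 ∧ p.2 % 12 = 5) then 2
  else if (p.1 % 24 = 2 ∧ p.2 % 12 = 5) ∨ (p.1 % 24 = 10 ∧ p.2 % 12 = 1) then -2
  else 0

noncomputable section ThetaPart

open Complex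

/-- Theta function with characteristics `(α, β)`, in the normalisation that behaves equivariantly. -/
def th (α β : ℝ) (τ : ℂ) : ℂ :=
  cexp (Real.pi * I * α * (α * τ + β)) * jacobiTheta₂ (α * τ + β) τ

/-- Product of two theta functions. -/
def thP (α β α' β' : ℝ) (τ : ℂ) : ℂ := th α β τ * th α' β' τ

lemma th_series (α β : ℝ) (τ : ℂ) :
    th α β τ = ∑' n : ℤ, cexp (Real.pi * I * ((n + α) ^ 2 * τ + (2 * n + α) * β)) := by
  rw [th, jacobiTheta₂, ← tsum_mul_left]
  refine tsum_congr fun n => ?_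
  rw [jacobiTheta₂_term, ← Complex.exp_add]
  congr 1
  ring

lemma th_summable (α β : ℝ) {τ : ℂ} (hτ : 0 < τ.im) :
    Summable fun n : ℤ => cexp (Real.pi * I * ((n + α) ^ 2 * τ + (2 * n + α) * β)) := by
  have := ((summable_jacobiTheta₂_term_iff (α * τ + β) τ).mpr hτ).mul_left
    (cexp (Real.pi * I * α * (α * τ + β)))
  refine this.congr fun n => ?_
  rw [jacobiTheta₂_term, ← Complex.exp_add]
  congr 1
  ring

lemma exp_int_eq {x y : ℂ} (k : ℤ) (h : x = y + k * (2 * Real.pi * I)) : cexp x = cexp y := by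
  rw [h, Complex.exp_add, Complex.exp_int_mul_two_pi_mul_I, mul_one]

lemma th_T2 (α β : ℝ) (τ : ℂ) (k : ℤ) : th α β (τ + 2 * k) = th α (β + 2 * k * α) τ := by
  rw [th_series, th_series]
  refine tsum_congr fun n => ?_
  apply exp_int_eq (n ^ 2 * k)
  push_cast
  ring

lemma th_T1 (α β : ℝ) (τ : ℂ) :
    th α β (τ + 1) = cexp (-(Real.pi * I * α / 2)) * th α (β + α + 1 / 2) τ := by
  rw [th_series, th_series, ← tsum_mul_left]
  refine tsum_congr fun n => ?_
  rw [← Complex.exp_add]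
  obtain ⟨k, hk⟩ := Int.even_mul_pred_self n
  have hk' : (n : ℂ) * (n - 1) = k + k := by exact_mod_cast hk
  apply exp_int_eq k
  push_cast
  linear_combination (Real.pi * I) * hk'

lemma th_neg (α β : ℝ) (τ : ℂ) : th (-α) (-β) τ = th α β τ := by
  rw [th, th, ← jacobiTheta₂_neg_left]
  congr 1
  · push_cast; congr 1; ring
  · push_cast; congr 1; ring

lemma th_S (α β : ℝ) {τ : ℂ} (hτ : 0 < τ.im) :
    th α β (-1 / τ) = (-I * τ) ^ (1 / 2 : ℂ) * th β (-α) τ := by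
  have h0 : τ ≠ 0 := by rintro rfl; simp at hτ
  have h1 : (-I * τ) ^ (1 / 2 : ℂ) ≠ 0 := by
    simp [Complex.cpow_eq_zero_iff, h0]
  rw [th, th, jacobiTheta₂_functional_equation (β * τ + (-α : ℝ)) τ]
  have e1 : (β * τ + (-α : ℝ)) / τ = α * (-1 / τ) + β := by
    push_cast; field_simp; ring
  rw [e1]
  have e2 : cexp (Real.pi * I * α * (α * (-1 / τ) + β)) =
      cexp (Real.pi * I * β * (β * τ + (-α : ℝ))) *
        cexp (-Real.pi * I * (β * τ + (-α : ℝ)) ^ 2 / τ) := by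
    rw [← Complex.exp_add]
    congr 1
    push_cast; field_simp; ring
  rw [e2]
  field_simp

lemma thP_S (α β α' β' : ℝ) {τ : ℂ} (hτ : 0 < τ.im) :
    thP α β α' β' (-1 / τ) = (-I * τ) * thP β (-α) β' (-α') τ := by
  have h0 : τ ≠ 0 := by rintro rfl; simp at hτ
  rw [thP, thP, th_S _ _ hτ, th_S _ _ hτ]
  have : (-I * τ) ^ (1 / 2 : ℂ) * (-I * τ) ^ (1 / 2 : ℂ) = -I * τ := by
    rw [← Complex.cpow_add _ _ (by simp [h0])]
    norm_num
  linear_combination th β (-α) τ * th β' (-α') τ * this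

lemma thP_T2 (α β α' β' : ℝ) (τ : ℂ) (k : ℤ) :
    thP α β α' β' (τ + 2 * k) = thP α (β + 2 * k * α) α' (β' + 2 * k * α') τ := by
  rw [thP, thP, th_T2, th_T2]

lemma im_neg_inv_pos {τ : ℂ} (hτ : 0 < τ.im) : 0 < (-1 / τ).im := by
  have h0 : τ ≠ 0 := by rintro rfl; simp at hτ
  rw [neg_div, one_div, Complex.neg_im, Complex.inv_im, neg_div, neg_neg]
  exact div_pos hτ (Complex.normSq_pos.mpr h0)

lemma thP_V (α β α' β' : ℝ) {τ : ℂ} (hτ : 0 < τ.im) (k : ℤ) :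
    thP α β α' β' (τ / (2 * k * τ + 1)) =
      (2 * k * τ + 1) * thP (α + 2 * k * β) β (α' + 2 * k * β') β' τ := by
  have h0 : τ ≠ 0 := by rintro rfl; simp at hτ
  have hi := im_neg_inv_pos hτ
  set σ : ℂ := -1 / τ + 2 * (-k : ℤ) with hσ
  have hσi : 0 < σ.im := by
    have : σ.im = (-1 / τ).im := by
      rw [hσ, Complex.add_im]
      have : ((2 : ℂ) * (-k : ℤ)).im = 0 := by
        have : ((2 : ℂ) * (-k : ℤ)) = ((2 * (-k) : ℤ) : ℂ) := by push_cast; ring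
        rw [this, Complex.intCast_im]
      rw [this, add_zero]
    rw [this]; exact hi
  have hσ0 : σ ≠ 0 := by intro h; rw [h] at hσi; simp at hσi
  have hst : σ * τ = -(2 * k * τ + 1) := by
    rw [hσ]; push_cast; field_simp; ring
  have hd : 2 * k * τ + 1 ≠ 0 := by
    intro h; rw [h, neg_zero] at hst; exact (mul_ne_zero hσ0 h0) hst
  have e : τ / (2 * k * τ + 1) = -1 / σ := by
    rw [div_eq_div_iff hd hσ0]; linear_combination hst
  rw [e, thP_S _ _ _ _ hσi, hσ, thP_T2, thP_S _ _ _ _ hτ, ← hσ]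
  have e2 : ∀ a b a' b' : ℝ, thP (-a) (-b) (-a') (-b') τ = thP a b a' b' τ := by
    intros; rw [thP, thP, th_neg, th_neg]
  have e3 := e2 (α + 2 * k * β) β (α' + 2 * k * β') β'
  rw [show -α + 2 * ((-k : ℤ) : ℝ) * β = -(α + 2 * k * β) by push_cast; ring,
    show -α' + 2 * ((-k : ℤ) : ℝ) * β' = -(α' + 2 * k * β') by push_cast; ring, e3]
  linear_combination (I ^ 2 * thP (α + 2 * k * β) β (α' + 2 * k * β') β' τ) * hst -
    (2 * k * τ + 1) * thP (α + 2 * k * β) β (α' + 2 * k * β') β' τ * Complex.I_sq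

/-- The sign character. -/
def sgn4 (d : ℤ) : ℂ := if d % 4 = 1 then 1 else -1

lemma denom_ne' {c d : ℤ} {τ : ℂ} (hτ : 0 < τ.im) (h : c ≠ 0 ∨ d ≠ 0) : (c * τ + d : ℂ) ≠ 0 := by
  intro h0
  have him := congrArg Complex.im h0
  have hre := congrArg Complex.re h0
  simp at him hre
  rcases him with hc | hc
  · subst hc
    simp at hre h
    exact h hre
  · exact hτ.ne' hc

lemma thP_Gamma2 (n : ℕ) : ∀ a b c d : ℤ, c.natAbs + d.natAbs ≤ n → a * d - b * c = 1 →
    b % 2 = 0 → c % 2 = 0 → ∀ (α β α' β' : ℝ) (τ : ℂ), 0 < τ.im →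
    thP α β α' β' ((a * τ + b) / (c * τ + d)) = sgn4 d * (c * τ + d) *
      thP (α * a + β * c) (α * b + β * d) (α' * a + β' * c) (α' * b + β' * d) τ := by
  induction n with
  | zero =>
    intro a b c d hn hdet
    have hc : c = 0 := by omega
    have hd : d = 0 := by omega
    subst hc hd
    simp at hdet
  | succ n ih =>
    intro a b c d hn hdet hb hc α β α' β' τ hτ
    have hd : d % 2 = 1 := by
      rcases Int.emod_two_eq_zero_or_one d with h | h
      · exfalso
        obtain ⟨x, rfl⟩ := Int.dvd_of_emod_eq_zero h
        obtain ⟨y, rfl⟩ := Int.dvd_of_emod_eq_zero hc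
        have : 2 * (a * x - b * y) = 1 := by linarith
        omega
      · exact h
    by_cases hc0 : c = 0
    · subst hc0
      simp at hdet
      obtain ⟨k, rfl⟩ := Int.dvd_of_emod_eq_zero hb
      rcases Int.eq_one_or_neg_one_of_mul_eq_one' hdet with ⟨rfl, rfl⟩ | ⟨rfl, rfl⟩
      · have := thP_T2 α β α' β' τ k
        simp only [sgn4]
        norm_num
        rw [this]
        congr 1 <;> ring
      · have := thP_T2 α β α' β' τ (-k)
        have e2 : ∀ a b a' b' : ℝ, thP (-a) (-b) (-a') (-b') τ = thP a b a' b' τ := by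
          intros; rw [thP, thP, th_neg, th_neg]
        rw [← e2]
        simp only [sgn4]
        norm_num
        push_cast at this
        rw [show (-τ + 2 * (k : ℂ)) / -1 = τ + 2 * -(k : ℂ) by ring, this]
        congr 1 <;> ring
    · have hne : (c * τ + d : ℂ) ≠ 0 := denom_ne' hτ (Or.inl hc0)
      rcases lt_or_ge c.natAbs d.natAbs with hlt | hge
      · -- translate
        obtain ⟨k, hk, hk2⟩ : ∃ k : ℤ, (d - 2 * k * c).natAbs < d.natAbs ∧ (k = 1 ∨ k = -1) := by
          by_cases hs : (d - 2 * c).natAbs < d.natAbs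
          · exact ⟨1, by simpa using hs, Or.inl rfl⟩
          · refine ⟨-1, ?_, Or.inr rfl⟩
            have : d - 2 * (-1) * c = d + 2 * c := by ring
            rw [this]; omega
        have h4 : sgn4 (d - 2 * k * c) = sgn4 d := by
          obtain ⟨y, rfl⟩ := Int.dvd_of_emod_eq_zero hc
          simp only [sgn4]
          have : (d - 2 * k * (2 * y)) % 4 = d % 4 := by
            rw [show d - 2 * k * (2 * y) = d + 4 * (-(k * y)) by ring]
            exact Int.add_mul_emod_self_left d 4 _
          rw [this]
        have him : 0 < (τ + 2 * k).im := by
          have : (τ + 2 * k).im = τ.im := by simp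
          rw [this]; exact hτ
        have := ih a (b - 2 * k * a) c (d - 2 * k * c) (by omega) (by linarith)
          (by rw [show b - 2 * k * a = b + 2 * (-(k * a)) by ring, Int.add_mul_emod_self_left]; exact hb)
          hc α β α' β' (τ + 2 * k) him
        rw [h4, thP_T2] at this
        push_cast at this
        rw [show (a * (τ + 2 * k) + (b - 2 * k * a) : ℂ) = a * τ + b by ring,
          show (c * (τ + 2 * k) + (d - 2 * k * c) : ℂ) = c * τ + d by ring] at this
        rw [this]
        congr 2 <;> ring
      · obtain ⟨k, hk, hk2⟩ : ∃ k : ℤ, (c - 2 * k * d).natAbs < c.natAbs ∧ (k = 1 ∨ k = -1) := by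
          by_cases hs : (c - 2 * d).natAbs < c.natAbs
          · exact ⟨1, by simpa using hs, Or.inl rfl⟩
          · refine ⟨-1, ?_, Or.inr rfl⟩
            have : c - 2 * (-1) * d = c + 2 * d := by ring
            rw [this]; omega
        have hne2 : (2 * k * τ + 1 : ℂ) ≠ 0 := by
          have := denom_ne' (c := 2 * k) (d := 1) hτ (Or.inr one_ne_zero)
          push_cast at this; exact this
        have him : 0 < (τ / (2 * k * τ + 1)).im := by
          have h0 : τ ≠ 0 := by rintro rfl; simp at hτ
          have e : τ / (2 * k * τ + 1) = -1 / (-1 / τ - (2 * k : ℤ)) := by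
            have : (-1 / τ - (2 * k : ℤ)) = -(2 * k * τ + 1) / τ := by
              push_cast; field_simp; ring
            rw [this]; field_simp
          rw [e]
          apply im_neg_inv_pos
          rw [Complex.sub_im, Complex.intCast_im, sub_zero]
          exact im_neg_inv_pos hτ
        have := ih (a - 2 * k * b) b (c - 2 * k * d) d (by omega) (by linarith)
          hb (by rw [show c - 2 * k * d = c + 2 * (-(k * d)) by ring, Int.add_mul_emod_self_left]; exact hc)
          α β α' β' (τ / (2 * k * τ + 1)) him
        rw [thP_V _ _ _ _ hτ] at this
        push_cast at this
        have e1 : ((a - 2 * k * b) * (τ / (2 * k * τ + 1)) + b : ℂ) = (a * τ + b) / (2 * k * τ + 1) := by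
          field_simp; ring
        have e2 : ((c - 2 * k * d) * (τ / (2 * k * τ + 1)) + d : ℂ) = (c * τ + d) / (2 * k * τ + 1) := by
          field_simp; ring
        rw [e1, e2, div_div_div_cancel_right₀ hne2] at this
        rw [this]
        rw [show ∀ X : ℂ, sgn4 d * ((c * τ + d) / (2 * k * τ + 1)) * ((2 * k * τ + 1) * X) =
          sgn4 d * (c * τ + d) * X by
            intro X
            rw [mul_assoc, ← mul_assoc (_ / _), div_mul_cancel₀ _ hne2, mul_assoc]]
        congr 2 <;> ring

lemma th_level (h b j : ℤ) (τ : ℂ) :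
    th ((h : ℝ) / 24 + j) (48 * b * h) τ = th ((h : ℝ) / 24) 0 τ := by
  rw [th_series, th_series]
  conv_rhs => rw [← (Equiv.addRight j).tsum_eq]
  refine tsum_congr fun n => ?_
  apply exp_int_eq (48 * b * h * n + b * h ^ 2 + 24 * b * h * j)
  push_cast [Equiv.coe_addRight]
  ring

lemma th_norm_le (α β : ℝ) {τ : ℂ} (hτ : 1 ≤ τ.im) :
    ‖th α β τ‖ ≤ ∑' n : ℤ, ‖cexp (Real.pi * I * ((n + α) ^ 2 * I + (2 * n + α) * (0 : ℝ)))‖ := by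
  rw [th_series]
  have hs := (th_summable α 0 (τ := I) (by simp)).norm
  refine tsum_of_norm_bounded hs.hasSum fun n => ?_
  rw [Complex.norm_exp, Complex.norm_exp, Real.exp_le_exp]
  have e : ∀ (σ : ℂ) (γ : ℝ), (Real.pi * I * ((n + α) ^ 2 * σ + (2 * n + α) * γ) : ℂ).re =
      -(Real.pi * (n + α) ^ 2 * σ.im) := by
    intro σ γ
    have : (Real.pi * I * ((n + α) ^ 2 * σ + (2 * n + α) * γ) : ℂ) =
      ((Real.pi * (n + α) ^ 2 : ℝ) : ℂ) * (I * σ) + ((Real.pi * (2 * n + α) * γ : ℝ) : ℂ) * I := by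
      push_cast; ring
    rw [this, Complex.add_re, Complex.re_ofReal_mul, Complex.re_ofReal_mul]
    simp
  rw [e, e, Complex.I_im]
  have : 0 ≤ Real.pi * (n + α) ^ 2 := by positivity
  nlinarith

lemma th_differentiableAt (α β : ℝ) {τ : ℂ} (hτ : 0 < τ.im) : DifferentiableAt ℂ (th α β) τ := by
  unfold th
  refine DifferentiableAt.mul (by fun_prop) ?_
  have h1 := (hasFDerivAt_jacobiTheta₂ (α * τ + β) hτ).differentiableAt
  have h2 : DifferentiableAt ℂ (fun t : ℂ => ((α * t + β, t) : ℂ × ℂ)) τ := by fun_prop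
  exact DifferentiableAt.comp (f := fun t : ℂ => ((α * t + β, t) : ℂ × ℂ)) τ h1 h2

end ThetaPart

noncomputable section ModularPart

open UpperHalfPlane hiding I
open Complex ModularGroup OnePoint
open scoped MatrixGroups ModularForm Manifold

/-- The product of theta functions on the upper half plane. -/
def pf (α β α' β' : ℝ) : ℍ → ℂ := fun τ => thP α β α' β' (τ : ℂ)

lemma pf_bdd (α β α' β' : ℝ) : IsBoundedAtImInfty (pf α β α' β') := by
  rw [isBoundedAtImInfty_iff]
  refine ⟨(∑' n : ℤ, ‖cexp (Real.pi * I * ((n + α) ^ 2 * I + (2 * n + α) * (0 : ℝ)))‖) *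
    (∑' n : ℤ, ‖cexp (Real.pi * I * ((n + α') ^ 2 * I + (2 * n + α') * (0 : ℝ)))‖), 1,
    fun z hz => ?_⟩
  rw [pf, thP, norm_mul]
  exact mul_le_mul (th_norm_le α β hz) (th_norm_le α' β' hz) (norm_nonneg _)
    (tsum_nonneg fun _ => norm_nonneg _)

lemma pf_mdiff (α β α' β' : ℝ) : MDiff (pf α β α' β') := by
  rw [UpperHalfPlane.mdifferentiable_iff]
  have : DifferentiableOn ℂ (thP α β α' β') {z | 0 < z.im} := fun z hz =>
    ((th_differentiableAt α β hz).mul (th_differentiableAt α' β' hz)).differentiableWithinAt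
  refine this.congr fun z hz => ?_
  simp [pf, ofComplex_apply_of_im_pos hz]

lemma pf_slash_S (α β α' β' : ℝ) :
    pf α β α' β' ∣[(1 : ℤ)] S = (-I) • pf β (-α) β' (-α') := by
  ext τ
  rw [ModularForm.SL_slash_apply, modular_S_smul]
  have := thP_S α β α' β' τ.im_pos
  have h0 : (τ : ℂ) ≠ 0 := τ.ne_zero
  have e : ((-τ : ℂ)⁻¹) = -1 / τ := by field_simp
  simp only [pf, Pi.smul_apply, smul_eq_mul]
  rw [e, this]
  have hd : denom (S : SL(2, ℤ)) τ = τ := by simp [denom, ModularGroup.coe_S]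
  rw [hd, zpow_neg_one]
  field_simp

lemma pf_slash_T (α β α' β' : ℝ) : ∃ C : ℂ, C ≠ 0 ∧
    pf α β α' β' ∣[(1 : ℤ)] T = C • pf α (β + α + 1 / 2) α' (β' + α' + 1 / 2) := by
  refine ⟨cexp (-(Real.pi * I * α / 2)) * cexp (-(Real.pi * I * α' / 2)),
    mul_ne_zero (exp_ne_zero _) (exp_ne_zero _), ?_⟩
  ext τ
  rw [ModularForm.SL_slash_apply, modular_T_smul]
  have hd : denom (T : SL(2, ℤ)) τ = 1 := by simp [denom, ModularGroup.coe_T]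
  rw [hd]
  simp only [pf, Pi.smul_apply, smul_eq_mul, thP]
  have e : (((1 : ℝ) +ᵥ τ : ℍ) : ℂ) = τ + 1 := by simp [add_comm]
  rw [e, th_T1, th_T1]
  simp
  ring

lemma pf_slash_SL (γ : SL(2, ℤ)) : ∀ α β α' β' : ℝ, ∃ (C : ℂ) (a b a' b' : ℝ),
    pf α β α' β' ∣[(1 : ℤ)] γ = C • pf a b a' b' := by
  have hγ : γ ∈ Subgroup.closure {S, T} := by simp [_root_.SpecialLinearGroup.SL2Z_generators]
  induction hγ using Subgroup.closure_induction_right with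
  | one =>
    intro α β α' β'
    exact ⟨1, α, β, α', β', by simp [SlashAction.slash_one]⟩
  | mul_right x hx y hy ih =>
    intro α β α' β'
    obtain ⟨C, a, b, a', b', h⟩ := ih α β α' β'
    rw [SlashAction.slash_mul, h, ModularForm.SL_smul_slash]
    rcases hy with rfl | rfl
    · rw [pf_slash_S, smul_smul]
      exact ⟨_, _, _, _, _, rfl⟩
    · obtain ⟨D, -, hD⟩ := pf_slash_T a b a' b'
      rw [hD, smul_smul]
      exact ⟨_, _, _, _, _, rfl⟩
  | mul_inv_cancel x hx y hy ih =>
    intro α β α' β'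
    obtain ⟨C, a, b, a', b', h⟩ := ih α β α' β'
    rw [SlashAction.slash_mul, h, ModularForm.SL_smul_slash]
    rcases hy with rfl | rfl
    · have := pf_slash_S (-b) a (-b') a'
      rw [neg_neg, neg_neg] at this
      have h2 : pf a b a' b' = I • (pf (-b) a (-b') a' ∣[(1 : ℤ)] S) := by
        rw [this, smul_smul]; simp
      rw [h2, ModularForm.SL_smul_slash, ← SlashAction.slash_mul, mul_inv_cancel,
        SlashAction.slash_one, smul_smul]
      exact ⟨_, _, _, _, _, rfl⟩
    · obtain ⟨D, hD0, hD⟩ := pf_slash_T a (b - a - 1 / 2) a' (b' - a' - 1 / 2)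
      rw [show b - a - 1 / 2 + a + 1 / 2 = b by ring,
        show b' - a' - 1 / 2 + a' + 1 / 2 = b' by ring] at hD
      have h2 : pf a b a' b' = D⁻¹ • (pf a (b - a - 1 / 2) a' (b' - a' - 1 / 2) ∣[(1 : ℤ)] T) := by
        rw [hD, smul_smul, inv_mul_cancel₀ hD0, one_smul]
      rw [h2, ModularForm.SL_smul_slash, ← SlashAction.slash_mul, mul_inv_cancel,
        SlashAction.slash_one, smul_smul]
      exact ⟨_, _, _, _, _, rfl⟩

/-- The scaling matrix. -/
def dm : GL (Fin 2) ℝ := Matrix.GeneralLinearGroup.mkOfDetNeZero !![1152, 0; 0, 1] (by simp)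

lemma dm_det : dm.det.val = 1152 := by simp [dm, Matrix.GeneralLinearGroup.mkOfDetNeZero]

lemma pf_slash_dm (α β α' β' : ℝ) (τ : ℍ) :
    (pf α β α' β' ∣[(1 : ℤ)] dm) τ = thP α β α' β' (1152 * τ) := by
  have hpos : 0 < dm.det.val := by rw [dm_det]; norm_num
  have hden : denom dm τ = 1 := by simp [denom, dm, Matrix.GeneralLinearGroup.mkOfDetNeZero]
  have hnum : num dm τ = 1152 * τ := by simp [num, dm, Matrix.GeneralLinearGroup.mkOfDetNeZero]
  rw [ModularForm.slash_apply, hden, pf, coe_smul_of_det_pos hpos, hden, hnum]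
  rw [σ, if_pos hpos]
  simp

lemma dm_cusp {c : OnePoint ℝ} (hc : IsCusp c 𝒮ℒ) : IsCusp (dm • c) 𝒮ℒ := by
  rw [isCusp_SL2Z_iff] at hc ⊢
  obtain ⟨q, rfl⟩ := hc
  have h00 : dm 0 0 = 1152 := by simp [dm, Matrix.GeneralLinearGroup.mkOfDetNeZero]
  have h01 : dm 0 1 = 0 := by simp [dm, Matrix.GeneralLinearGroup.mkOfDetNeZero]
  have h10 : dm 1 0 = 0 := by simp [dm, Matrix.GeneralLinearGroup.mkOfDetNeZero]
  have h11 : dm 1 1 = 1 := by simp [dm, Matrix.GeneralLinearGroup.mkOfDetNeZero]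
  induction q using OnePoint.rec with
  | infty => exact ⟨∞, by simp [smul_infty_eq_ite, h10]⟩
  | coe x =>
    refine ⟨((1152 * x : ℚ) : OnePoint ℚ), ?_⟩
    simp [smul_some_eq_ite, h00, h01, h10, h11]

lemma pf_dm_cusp (α β α' β' : ℝ) {c : OnePoint ℝ} (hc : IsCusp c 𝒮ℒ) :
    c.IsBoundedAt (pf α β α' β' ∣[(1 : ℤ)] dm) 1 := by
  rw [← IsBoundedAt.smul_iff, isBoundedAt_iff_forall_SL2Z (dm_cusp hc)]
  intro γ _
  obtain ⟨C, a, b, a', b', h⟩ := pf_slash_SL γ α β α' β'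
  rw [h]
  exact (pf_bdd a b a' b').const_smul_left C

lemma pf_dm_inv (h k : ℤ) (γ : SL(2, ℤ)) (hγ : γ ∈ CongruenceSubgroup.Gamma1 2304) :
    (pf ((h : ℝ) / 24) 0 ((k : ℝ) / 24) 0 ∣[(1 : ℤ)] dm) ∣[(1 : ℤ)] γ =
      pf ((h : ℝ) / 24) 0 ((k : ℝ) / 24) 0 ∣[(1 : ℤ)] dm := by
  ext τ
  rw [ModularForm.slash_action_eq'_iff, pf_slash_dm, pf_slash_dm, zpow_one]
  obtain ⟨h1, h2, h3⟩ := (CongruenceSubgroup.Gamma1_mem _ _).mp hγ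
  have hdet := γ.det_coe
  rw [Matrix.det_fin_two] at hdet
  rw [coe_specialLinearGroup_apply]
  generalize γ 0 0 = a at *
  generalize γ 0 1 = b at *
  generalize γ 1 0 = c at *
  generalize γ 1 1 = d at *
  have h1' : ((a - 1 : ℤ) : ZMod 2304) = 0 := by push_cast; rw [h1, sub_self]
  have h2' : ((d - 1 : ℤ) : ZMod 2304) = 0 := by push_cast; rw [h2, sub_self]
  rw [ZMod.intCast_zmod_eq_zero_iff_dvd] at h1' h2' h3
  obtain ⟨A, hA⟩ := h1'
  obtain ⟨E, hE⟩ := h2'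
  obtain ⟨c', rfl⟩ := h3
  push_cast at hA hE hdet
  obtain rfl : a = 1 + 2304 * A := by linarith
  have him : 0 < (1152 * (τ : ℂ)).im := by
    have : (1152 * (τ : ℂ)).im = 1152 * τ.im := by simp
    rw [this]; have := τ.im_pos; positivity
  have key := thP_Gamma2 _ (1 + 2304 * A) (1152 * b) (2 * c') d le_rfl (by linarith) (by omega)
    (by omega) ((h : ℝ) / 24) 0 ((k : ℝ) / 24) 0 (1152 * τ) him
  have hs : sgn4 d = 1 := by
    rw [sgn4, if_pos]; omega
  rw [hs] at key
  have e1 : ∀ m : ℤ, th ((m : ℝ) / 24 * ((1 + 2304 * A : ℤ) : ℝ) + 0 * ((2 * c' : ℤ) : ℝ))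
      ((m : ℝ) / 24 * ((1152 * b : ℤ) : ℝ) + 0 * (d : ℝ)) (1152 * τ) =
      th ((m : ℝ) / 24) 0 (1152 * τ) := by
    intro m
    rw [← th_level m b (96 * m * A)]
    congr 1 <;> push_cast <;> ring
  have e2 : ((((1 + 2304 * A : ℤ) : ℂ) * (1152 * τ) + ((1152 * b : ℤ) : ℂ)) /
      (((2 * c' : ℤ) : ℂ) * (1152 * τ) + d)) =
      1152 * ((((algebraMap ℤ ℝ (1 + 2304 * A) : ℝ) : ℂ) * τ + ((algebraMap ℤ ℝ b : ℝ) : ℂ)) /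
        (((algebraMap ℤ ℝ (((2304 : ℕ) : ℤ) * c') : ℝ) : ℂ) * τ + ((algebraMap ℤ ℝ d : ℝ) : ℂ))) := by
    rw [← mul_div_assoc]
    simp only [algebraMap_int_eq, eq_intCast]
    push_cast
    congr 1 <;> ring
  rw [thP, thP, e1, e1, ← thP, ← thP, e2] at key
  rw [key]
  push_cast
  ring

end ModularPart

noncomputable section FinalPart

open UpperHalfPlane hiding I
open Complex
open scoped MatrixGroups ModularForm Manifold

lemma exists_form (h k : ℤ) : ∃ F : ModularForm (CongruenceSubgroup.Gamma1 2304) 1,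
    ∀ τ : ℍ, F τ = th ((h : ℝ) / 24) 0 (1152 * τ) * th ((k : ℝ) / 24) 0 (1152 * τ) := by
  refine ⟨{ toFun := pf ((h : ℝ) / 24) 0 ((k : ℝ) / 24) 0 ∣[(1 : ℤ)] dm
            slash_action_eq' := ?_
            holo' := (pf_mdiff _ _ _ _).slash 1 dm
            bdd_at_cusps' := ?_ }, fun τ => pf_slash_dm _ _ _ _ τ⟩
  · rintro _ ⟨γ, hγ, rfl⟩
    exact pf_dm_inv h k γ hγ
  · intro c hc
    refine pf_dm_cusp _ _ _ _ ?_
    exact (Subgroup.IsArithmetic.isCusp_iff_isCusp_SL2Z _).mp hc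

lemma exists_sum {ι : Type*} (s : Finset ι) (C : ι → ℂ) (u v : ι → ℤ) :
    ∃ F : ModularForm (CongruenceSubgroup.Gamma1 2304) 1,
    ∀ τ : ℍ, F τ = ∑ i ∈ s, C i *
      (th ((u i : ℝ) / 24) 0 (1152 * τ) * th ((v i : ℝ) / 24) 0 (1152 * τ)) := by
  classical
  induction s using Finset.induction_on with
  | empty => exact ⟨0, fun τ => by simp⟩
  | insert a s ha ih =>
    obtain ⟨F, hF⟩ := ih
    obtain ⟨G, hG⟩ := exists_form (u a) (v a)
    refine ⟨C a • G + F, fun τ => ?_⟩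
    rw [Finset.sum_insert ha, ← hF, ← hG]
    rfl

lemma th_scaled (h : ℤ) {τ : ℂ} (hτ : 0 < τ.im) :
    HasSum (fun n : ℤ => cexp (2 * Real.pi * I * ((n * 24 + h : ℤ) : ℂ) ^ 2 * τ))
      (th ((h : ℝ) / 24) 0 (1152 * τ)) := by
  have him : 0 < (1152 * τ).im := by
    have : (1152 * τ).im = 1152 * τ.im := by simp
    rw [this]; positivity
  rw [th_series]
  have := (th_summable ((h : ℝ) / 24) 0 him).hasSum
  convert this using 1
  ext n
  congr 1
  push_cast
  ring

lemma w_mod (x y m n : ℤ) : w (m * 24 + x, n * 24 + y) = w (x, y) := by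
  have e1 : (m * 24 + x) % 24 = x % 24 := by omega
  have e2 : (n * 24 + y) % 12 = y % 12 := by omega
  have e3 : (n * 24 + y) % 6 = y % 6 := by omega
  simp only [w, e1, e2, e3]

lemma hasSum_mul_prod {f g : ℤ → ℂ} {s t : ℂ} (hf : HasSum f s) (hg : HasSum g t) :
    HasSum (fun p : ℤ × ℤ => f p.1 * g p.2) (s * t) := by
  have h1 : Summable fun n => ‖f n‖ := hf.summable.norm
  have h2 : Summable fun n => ‖g n‖ := hg.summable.norm
  have h3 : Summable fun p : ℤ × ℤ => f p.1 * g p.2 := summable_mul_of_summable_norm h1 h2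
  exact HasSum.mul hf hg h3

lemma exists_residue_equiv : ∃ e : (Fin 24 × Fin 24) × (ℤ × ℤ) ≃ ℤ × ℤ, ∀ i p,
    e (i, p) = (p.1 * 24 + ((i.1 : ℕ) : ℤ), p.2 * 24 + ((i.2 : ℕ) : ℤ)) := by
  refine ⟨((Equiv.prodComm _ _).trans (Equiv.prodProdProdComm ℤ ℤ (Fin 24) (Fin 24))).trans
      (Equiv.prodCongr (Int.divModEquiv 24).symm (Int.divModEquiv 24).symm), fun i p => ?_⟩
  simp [Int.divModEquiv_symm_apply]

lemma stmt_aux : ∃ F : ModularForm (CongruenceSubgroup.Gamma1 2304) 1,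
      ∀ τ : UpperHalfPlane,
        F τ = ∑' p : ℤ × ℤ,
          (w p : ℂ) *
            Complex.exp (2 * Real.pi * Complex.I *
              ((p.1 : ℂ) ^ 2 + (p.2 : ℂ) ^ 2) * (τ : ℂ)) := by
  obtain ⟨F, hF⟩ := exists_sum (Finset.univ : Finset (Fin 24 × Fin 24))
    (fun i => (w ((i.1 : ℕ), (i.2 : ℕ)) : ℂ)) (fun i => (i.1 : ℕ)) (fun i => (i.2 : ℕ))
  refine ⟨F, fun τ => ?_⟩
  rw [hF]
  symm
  obtain ⟨e, he⟩ := exists_residue_equiv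
  rw [← e.tsum_eq]
  have hsum : ∀ i : Fin 24 × Fin 24, HasSum (fun p : ℤ × ℤ =>
      (w (e (i, p)) : ℂ) * cexp (2 * Real.pi * I *
        (((e (i, p)).1 : ℂ) ^ 2 + ((e (i, p)).2 : ℂ) ^ 2) * (τ : ℂ)))
      ((w ((i.1 : ℕ), (i.2 : ℕ)) : ℂ) *
        (th (((i.1 : ℕ) : ℤ) / 24 : ℝ) 0 (1152 * τ) * th (((i.2 : ℕ) : ℤ) / 24 : ℝ) 0 (1152 * τ))) := by
    intro i
    have h1 := th_scaled ((i.1 : ℕ) : ℤ) τ.im_pos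
    have h2 := th_scaled ((i.2 : ℕ) : ℤ) τ.im_pos
    have h3 := (hasSum_mul_prod h1 h2).mul_left
      (w ((i.1 : ℕ), (i.2 : ℕ)) : ℂ)
    refine Eq.mp (congrArg (fun f => HasSum f _) (funext fun p => ?_)) h3
    rw [he, w_mod, ← Complex.exp_add]
    refine congrArg _ (congrArg _ ?_)
    dsimp only
    ring
  have hs : Summable fun q : (Fin 24 × Fin 24) × (ℤ × ℤ) =>
      (w (e q) : ℂ) * cexp (2 * Real.pi * I *
        (((e q).1 : ℂ) ^ 2 + ((e q).2 : ℂ) ^ 2) * (τ : ℂ)) := by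
    apply Summable.of_norm
    rw [summable_prod_of_nonneg (fun _ => norm_nonneg _)]
    exact ⟨fun i => (hsum i).summable.norm, (hasSum_fintype _).summable⟩
  rw [hs.tsum_prod' fun i => (hsum i).summable, tsum_fintype]
  exact Finset.sum_congr rfl fun i _ => (hsum i).tsum_eq

end FinalPart

/-- The threefield theta series `Θ(τ) = Σ_{(x,y)∈ℤ²} w(x,y) e^{2πi(x²+y²)τ}`
is a modular form of weight `1` for `Γ₁(2304)`. -/
theorem stmt_16 :
    ∃ F : ModularForm (CongruenceSubgroup.Gamma1 2304) 1,
      ∀ τ : UpperHalfPlane,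
        F τ = ∑' p : ℤ × ℤ,
          (w p : ℂ) *
            Complex.exp (2 * Real.pi * Complex.I *
              ((p.1 : ℂ) ^ 2 + (p.2 : ℂ) ^ 2) * (τ : ℂ)) := by
  exact stmt_aux
end
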